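/- arXiv:0903.1359 — 4 statements merged into one kernel-verified Lean document; each statement's English description precedes it below -/
import Mathlib

section
/- Let n, k be positive integers with k+1 coprime to n, let A ⊆ ℤ_n with |A| = k+1, and let F be a field whose characteristic does not divide n containing a primitive n-th root of unity ω. Let R ⊆ D_{n,k} be a set containing exactly one point of each orbit of G_{n,k} on D_{n,k}. Then the map Θ sending φ ∈ Z^{k−1}(X_A;F) to the tuple (φ̂|_{E_u} : u ∈ R) ∈ ⊕_{u∈R} L_u is a surjective F-linear map with kernel B^{k−1}(X_A;F); in particular dim_F Z^{k−1}(X_A;F) − dim_F B^{k−1}(X_A;F) = ∑_{u∈R} dim_F L_u. -/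
open scoped BigOperators

/-- `e(x) = ω^x` for `x ∈ ℤ_n`. -/
noncomputable def eF (n : ℕ) [NeZero n] (F : Type*) [Field F] (ω : F) (x : ZMod n) : F :=
  ω ^ x.val

/-- A function `φ : ℤ_n^k → F` is alternating: permuting the coordinates multiplies the
value by the sign of the permutation, and the value vanishes on tuples with a repeated
coordinate. -/
def IsAlt (n : ℕ) [NeZero n] (F : Type*) [Field F] (k : ℕ)
    (φ : (Fin k → ZMod n) → F) : Prop :=
  (∀ (π : Equiv.Perm (Fin k)) (v : Fin k → ZMod n),
      φ (v ∘ π) = (Equiv.Perm.sign π : ℤ) • φ v) ∧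
  (∀ v : Fin k → ZMod n, ¬ Function.Injective v → φ v = 0)

/-- The Fourier transform of `φ : ℤ_n^k → F`:
`φ̂(u) = ∑_x φ(x) e(-∑_j u_j x_j)`. -/
noncomputable def fourierT (n : ℕ) [NeZero n] (F : Type*) [Field F] (ω : F) (k : ℕ)
    (φ : (Fin k → ZMod n) → F) : (Fin k → ZMod n) → F :=
  fun u => ∑ x : Fin k → ZMod n, φ x * eF n F ω (-(∑ j, u j * x j))

/-- Deletion of the `i`-th coordinate of a `k`-tuple (0-indexed). -/
def delCoord (n : ℕ) {k : ℕ} (i : Fin k) (v : Fin k → ZMod n) : Fin (k - 1) → ZMod n :=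
  fun j =>
    if h : (j : ℕ) < (i : ℕ) then v ⟨(j : ℕ), lt_trans h i.isLt⟩
    else v ⟨(j : ℕ) + 1, by have := j.isLt; omega⟩

/-- The automorphism `T` of `ℤ_n^k`:
`T(u_1,…,u_k) = (u_2 - u_1, …, u_k - u_1, -u_1)` (0-indexed). -/
def Ttrans (n k : ℕ) (u : Fin k → ZMod n) : Fin k → ZMod n :=
  fun i =>
    (if h : (i : ℕ) + 1 < k then u ⟨(i : ℕ) + 1, h⟩ else 0) -
      u ⟨0, Nat.lt_of_le_of_lt (Nat.zero_le _) i.isLt⟩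

/-- `D_{n,k}`: the tuples in `ℤ_n^k` with all coordinates nonzero and pairwise
distinct. -/
def Dset (n k : ℕ) : Set (Fin k → ZMod n) :=
  {u | (∀ i, u i ≠ 0) ∧ Function.Injective u}

/-- `E_u = {T^i u : 0 ≤ i ≤ k}`. -/
def Eset (n k : ℕ) (u : Fin k → ZMod n) : Set (Fin k → ZMod n) :=
  {v | ∃ i ≤ k, (Ttrans n k)^[i] u = v}

/-- Generating relation of the group `G_{n,k}` generated by `T` and the coordinate
permutations; its equivalence closure `EqvGen` has the orbits of `G_{n,k}` as its
classes. -/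
def genRel (n k : ℕ) (u v : Fin k → ZMod n) : Prop :=
  v = Ttrans n k u ∨ ∃ σ : Equiv.Perm (Fin k), v = u ∘ σ

/-- The space `L_u` of functions `g : E_u → F` with
`g(u) + ∑_{i=1}^k (-1)^{ki} e(-u_i a) g(T^i u) = 0` for every `a ∈ A`. -/
def Lsub (n : ℕ) [NeZero n] (F : Type*) [Field F] (ω : F) (k : ℕ)
    (A : Finset (ZMod n)) (u : Fin k → ZMod n) : Set (↥(Eset n k u) → F) :=
  {g | ∀ a ∈ A, g ⟨u, ⟨0, Nat.zero_le k, rfl⟩⟩ +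
      ∑ i : Fin k, (-1 : F) ^ (k * ((i : ℕ) + 1)) * eF n F ω (-(u i * a)) *
        g ⟨(Ttrans n k)^[(i : ℕ) + 1] u, ⟨(i : ℕ) + 1, i.isLt, rfl⟩⟩ = 0}

/-- The cocycle space `Z^{k-1}(X_A;F)`: alternating functions `φ` on `ℤ_n^k` such that
for every facet `{v_0,…,v_k}` of the sum complex `X_A` (enumerated injectively, with
sum of vertices in `A`), `∑_i (-1)^i φ(v_0,…,v̂_i,…,v_k) = 0`. -/
def Zset (n : ℕ) [NeZero n] (F : Type*) [Field F] (k : ℕ) (A : Finset (ZMod n)) :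
    Set ((Fin k → ZMod n) → F) :=
  {φ | IsAlt n F k φ ∧ ∀ v : Fin (k + 1) → ZMod n, Function.Injective v →
      (∑ i, v i) ∈ A →
      ∑ i : Fin (k + 1), (-1 : F) ^ (i : ℕ) * φ (fun j => v (i.succAbove j)) = 0}

/-- The coboundary space `B^{k-1}(X_A;F)`: images under `d_{k-2}` of alternating
functions on `ℤ_n^{k-1}`. -/
def Bset (n : ℕ) [NeZero n] (F : Type*) [Field F] (k : ℕ) :
    Set ((Fin k → ZMod n) → F) :=
  {φ | ∃ ψ : (Fin (k - 1) → ZMod n) → F, IsAlt n F (k - 1) ψ ∧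
      φ = fun v => ∑ i : Fin k, (-1 : F) ^ (i : ℕ) * ψ (delCoord n i v)}

namespace SumComplex

theorem natCast_ne_zero_of_not_ringChar_dvd {n : ℕ} {F : Type*} [Field F]
    (hchar : ¬ ringChar F ∣ n) : (n : F) ≠ 0 :=
  fun h => hchar ((ringChar.spec F n).1 h)

section Character

variable {n : ℕ} [NeZero n] {F : Type*} [Field F] {ω : F}

theorem eF_add (hω : IsPrimitiveRoot ω n) (x y : ZMod n) :
    eF n F ω (x + y) = eF n F ω x * eF n F ω y := by
  unfold eF
  rw [← pow_add, ZMod.val_add, ← pow_eq_pow_mod _ hω.pow_eq_one]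

theorem eF_zero : eF n F ω 0 = 1 := by
  simp [eF]

theorem eF_eq_one_iff (hω : IsPrimitiveRoot ω n) (x : ZMod n) : eF n F ω x = 1 ↔ x = 0 := by
  unfold eF
  rw [hω.pow_eq_one_iff_dvd]
  refine ⟨fun h => ?_, fun h => by simp [h]⟩
  exact (ZMod.val_eq_zero x).1 (Nat.eq_zero_of_dvd_of_lt h (ZMod.val_lt x))

theorem eF_ne_zero (hω : IsPrimitiveRoot ω n) (x : ZMod n) : eF n F ω x ≠ 0 :=
  pow_ne_zero _ (hω.ne_zero (NeZero.ne n))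

theorem eF_sum (hω : IsPrimitiveRoot ω n) {ι : Type*} (s : Finset ι) (f : ι → ZMod n) :
    eF n F ω (∑ i ∈ s, f i) = ∏ i ∈ s, eF n F ω (f i) := by
  classical
  induction s using Finset.induction_on with
  | empty => simp [eF_zero]
  | insert i s hi ih => rw [Finset.sum_insert hi, Finset.prod_insert hi, eF_add hω, ih]

/-- Orthogonality of the characters of `ℤ_n`. -/
theorem sum_eF_neg_mul (hω : IsPrimitiveRoot ω n) (u : ZMod n) :
    ∑ t : ZMod n, eF n F ω (-(u * t)) = if u = 0 then (n : F) else 0 := by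
  split_ifs with h
  · simp [h, eF_zero, ZMod.card]
  · let χ : AddChar (ZMod n) F :=
      { toFun := fun t => eF n F ω (-(u * t))
        map_zero_eq_one' := by simp [eF_zero]
        map_add_eq_mul' := fun s t => by rw [← eF_add hω]; congr 1; ring }
    refine AddChar.sum_eq_zero_of_ne_one (ψ := χ) fun hχ => h ?_
    have h1 : χ 1 = 1 := by rw [hχ]; rfl
    have h2 : eF n F ω (-(u * 1)) = 1 := h1
    simpa using (eF_eq_one_iff hω _).1 h2

theorem sum_eF_neg_dot (hω : IsPrimitiveRoot ω n) {k : ℕ} (u : Fin k → ZMod n) :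
    ∑ x : Fin k → ZMod n, eF n F ω (-(∑ j, u j * x j)) = if u = 0 then (n : F) ^ k else 0 := by
  have h1 : ∑ x : Fin k → ZMod n, eF n F ω (-(∑ j, u j * x j))
      = ∏ j, ∑ t : ZMod n, eF n F ω (-(u j * t)) := by
    rw [Finset.prod_univ_sum, Fintype.piFinset_univ]
    refine Finset.sum_congr rfl fun x _ => ?_
    rw [← Finset.sum_neg_distrib, eF_sum hω]
  rw [h1]
  simp only [sum_eF_neg_mul hω]
  split_ifs with h
  · simp [h]
  · obtain ⟨j, hj⟩ := Function.ne_iff.1 h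
    exact Finset.prod_eq_zero (Finset.mem_univ j) (if_neg hj)

theorem fourierT_fourierT (hω : IsPrimitiveRoot ω n) {k : ℕ} (g : (Fin k → ZMod n) → F)
    (x : Fin k → ZMod n) :
    fourierT n F ω k (fourierT n F ω k g) x = (n : F) ^ k * g (-x) := by
  unfold fourierT
  simp only [Finset.sum_mul]
  rw [Finset.sum_comm]
  have h1 : ∀ y : Fin k → ZMod n, ∑ u : Fin k → ZMod n,
      g y * eF n F ω (-(∑ j, u j * y j)) * eF n F ω (-(∑ j, x j * u j))
      = g y * (if x + y = 0 then (n : F) ^ k else 0) := by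
    intro y
    rw [← sum_eF_neg_dot hω, Finset.mul_sum]
    refine Finset.sum_congr rfl fun u _ => ?_
    rw [mul_assoc, ← eF_add hω, ← neg_add, ← Finset.sum_add_distrib]
    congr 3
    refine Finset.sum_congr rfl fun j _ => ?_
    simp only [Pi.add_apply]
    ring
  simp only [h1, mul_ite, mul_zero]
  rw [Finset.sum_eq_single (-x)]
  · simp [mul_comm]
  · intro y _ hy
    rw [if_neg]
    intro h
    exact hy (eq_neg_of_add_eq_zero_right h)
  · simp

theorem fourierT_injective (hchar : ¬ ringChar F ∣ n) (hω : IsPrimitiveRoot ω n) {k : ℕ} :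
    Function.Injective (fourierT n F ω k) := by
  intro f g h
  funext x
  have h1 := fourierT_fourierT hω f (-x)
  rw [h, fourierT_fourierT hω g (-x), neg_neg] at h1
  exact (mul_left_cancel₀ (pow_ne_zero _ (natCast_ne_zero_of_not_ringChar_dvd hchar)) h1).symm

theorem fourierT_comp_perm {k : ℕ} (φ : (Fin k → ZMod n) → F)
    (π : Equiv.Perm (Fin k)) (u : Fin k → ZMod n) :
    fourierT n F ω k φ (u ∘ π) = fourierT n F ω k (fun x => φ (x ∘ π)) u := by
  unfold fourierT
  refine (Equiv.sum_comp (Equiv.arrowCongr π.symm (Equiv.refl (ZMod n))) _).symm.trans ?_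
  refine Finset.sum_congr rfl fun x _ => ?_
  have h1 : (Equiv.arrowCongr π.symm (Equiv.refl (ZMod n))) x = x ∘ π := by
    funext j; simp [Equiv.arrowCongr]
  rw [h1]
  congr 3
  exact Equiv.sum_comp π (fun j => u j * x j)

/-- The Fourier transform of an alternating function is alternating. -/
theorem isAlt_fourierT {k : ℕ} {φ : (Fin k → ZMod n) → F} (hφ : IsAlt n F k φ) :
    IsAlt n F k (fourierT n F ω k φ) := by
  refine ⟨fun π u => ?_, fun u hu => ?_⟩
  · rw [fourierT_comp_perm]
    simp only [hφ.1 π, fourierT, zsmul_eq_mul, Finset.mul_sum, mul_assoc]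
  · simp only [Function.Injective, not_forall] at hu
    obtain ⟨p, q, hpq, hne⟩ := hu
    unfold fourierT
    refine Finset.sum_involution (fun x _ => x ∘ Equiv.swap p q) ?_ ?_ (by simp) ?_
    · intro x _
      have h1 : ∑ j, u j * (x ∘ Equiv.swap p q) j = ∑ j, u j * x j := by
        rw [← Equiv.sum_comp (Equiv.swap p q) (fun j => u j * x j)]
        refine Finset.sum_congr rfl fun j _ => ?_
        have : u (Equiv.swap p q j) = u j := by
          rw [Equiv.swap_apply_def]; split_ifs <;> simp_all
        simp [this]
      rw [h1, hφ.1, Equiv.Perm.sign_swap hne]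
      simp
    · intro x _ hx hfix
      apply hx
      rw [hφ.2 x, zero_mul]
      intro hinj
      have h2 := congrFun hfix p
      simp only [Function.comp_apply, Equiv.swap_apply_left] at h2
      exact hne (hinj h2).symm
    · intro x _
      funext j
      simp

theorem exists_fourierT_eq (hchar : ¬ ringChar F ∣ n) (hω : IsPrimitiveRoot ω n) {k : ℕ}
    {g : (Fin k → ZMod n) → F} (hg : IsAlt n F k g) :
    ∃ φ, IsAlt n F k φ ∧ fourierT n F ω k φ = g := by
  have hn := natCast_ne_zero_of_not_ringChar_dvd hchar
  have hG : IsAlt n F k (fourierT n F ω k g) := isAlt_fourierT hg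
  refine ⟨fun x => ((n : F) ^ k)⁻¹ * fourierT n F ω k g (-x), ⟨fun π v => ?_, fun v hv => ?_⟩, ?_⟩
  · have : -(v ∘ π) = (-v) ∘ π := rfl
    simp only [this, hG.1, zsmul_eq_mul]
    ring
  · simp only
    rw [hG.2, mul_zero]
    intro h
    apply hv
    intro i j hij
    exact h (by simp [hij])
  · funext u
    have h1 := fourierT_fourierT hω g (-u)
    rw [neg_neg] at h1
    rw [← mul_right_inj' (pow_ne_zero k hn), ← h1]
    unfold fourierT
    rw [Finset.mul_sum, ← Equiv.sum_comp (Equiv.neg (Fin k → ZMod n))]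
    refine Finset.sum_congr rfl fun x _ => ?_
    simp only [Equiv.neg_apply, neg_neg, ← mul_assoc]
    rw [mul_inv_cancel₀ (pow_ne_zero k hn), one_mul]
    simp

end Character

/-- The sign of a permutation as an element of a ring. -/
def sgn (R : Type*) [Ring R] {k : ℕ} (π : Equiv.Perm (Fin k)) : R :=
  ((Equiv.Perm.sign π : ℤ) : R)

section Sign

variable {R : Type*} [CommRing R] {k : ℕ}

theorem sgn_mul (π ρ : Equiv.Perm (Fin k)) : sgn R (π * ρ) = sgn R π * sgn R ρ := by
  simp [sgn]

theorem sgn_one : sgn R (1 : Equiv.Perm (Fin k)) = 1 := by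
  simp [sgn]

theorem sgn_mul_self (π : Equiv.Perm (Fin k)) : sgn R π * sgn R π = 1 := by
  unfold sgn
  rw [← Int.cast_mul, ← Units.val_mul, Int.units_mul_self]
  simp

theorem sgn_swap {p q : Fin k} (h : p ≠ q) : sgn R (Equiv.swap p q) = -1 := by
  simp [sgn, Equiv.Perm.sign_swap h]

theorem sgn_inv (π : Equiv.Perm (Fin k)) : sgn R π⁻¹ = sgn R π := by
  simp [sgn]

theorem sgn_cycleRange_symm (i : Fin k) :
    sgn R (Equiv.symm i.cycleRange) = (-1) ^ (i : ℕ) := by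
  simp [sgn, Fin.sign_cycleRange]

theorem exists_perm_of_apply_zero_eq_zero {τ : Equiv.Perm (Fin (k + 1))} (hτ : τ 0 = 0) :
    ∃ π : Equiv.Perm (Fin k), sgn R π = sgn R τ ∧ ∀ j : Fin k, τ j.succ = (π j).succ := by
  obtain ⟨⟨p, π⟩, rfl⟩ := Equiv.Perm.decomposeFin.symm.surjective τ
  rw [Equiv.Perm.decomposeFin_symm_apply_zero] at hτ
  subst hτ
  refine ⟨π, ?_, fun j => ?_⟩
  · simp [sgn, Equiv.Perm.decomposeFin.symm_sign]
  · rw [Equiv.Perm.decomposeFin_symm_apply_succ]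
    simp

/-- The extension of a permutation by a fixed point at `0`. -/
theorem exists_perm_extending (π : Equiv.Perm (Fin k)) :
    ∃ τ : Equiv.Perm (Fin (k + 1)), sgn R τ = sgn R π ∧ τ 0 = 0 ∧
      ∀ j : Fin k, τ j.succ = (π j).succ := by
  refine ⟨Equiv.Perm.decomposeFin.symm (0, π), ?_, ?_, fun j => ?_⟩
  · simp [sgn, Equiv.Perm.decomposeFin.symm_sign]
  · simp
  · simp

theorem finRotate_pow_apply_zero (i : Fin (k + 1)) :
    (finRotate (k + 1) ^ (i : ℕ)) 0 = i := by
  have h : ∀ m : ℕ, m < k + 1 → (((finRotate (k + 1) ^ m) 0 : Fin (k + 1)) : ℕ) = m := by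
    intro m
    induction m with
    | zero => simp
    | succ m ih =>
      intro hm
      have h1 := ih (by omega)
      rw [pow_succ', Equiv.Perm.mul_apply, finRotate_apply, Fin.val_add_one_of_lt, h1]
      rw [Fin.lt_def, h1]
      simp
      omega
  exact Fin.ext (h i i.isLt)

theorem sgn_finRotate_pow (m : ℕ) : sgn R (finRotate (k + 1) ^ m) = (-1) ^ (k * m) := by
  simp [sgn, sign_finRotate, pow_mul]

end Sign

section AltSum

variable {X F : Type*} [Field F] {k : ℕ}

/-- A function of `k + 1` variables that is alternating in the last `k` of them. -/
def IsAltTail (h : (Fin (k + 1) → X) → F) : Prop :=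
  (∀ τ : Equiv.Perm (Fin (k + 1)), τ 0 = 0 → ∀ U, h (U ∘ τ) = sgn F τ * h U) ∧
    ∀ U, ¬ Function.Injective (U ∘ Fin.succ) → h U = 0

/-- The weighted alternation of `h` over the choice of the distinguished variable. -/
def altSum (c : X → F) (h : (Fin (k + 1) → X) → F) (U : Fin (k + 1) → X) : F :=
  ∑ i, c (U i) * (sgn F (Equiv.symm i.cycleRange) * h (U ∘ Equiv.symm i.cycleRange))

theorem IsAltTail.sgn_mul_comp_eq {h : (Fin (k + 1) → X) → F} (hh : IsAltTail h)
    {ρ ρ' : Equiv.Perm (Fin (k + 1))} (h0 : ρ 0 = ρ' 0) (U : Fin (k + 1) → X) :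
    sgn F ρ * h (U ∘ ρ) = sgn F ρ' * h (U ∘ ρ') := by
  have h2 : U ∘ ρ' = (U ∘ ρ) ∘ (ρ⁻¹ * ρ' : Equiv.Perm _) := by
    funext j; simp
  rw [h2, hh.1 (ρ⁻¹ * ρ') (by rw [Equiv.Perm.mul_apply, ← h0]; simp), ← mul_assoc, ← sgn_mul]
  congr 1
  rw [sgn_mul, sgn_mul, sgn_inv, mul_left_comm, sgn_mul_self, mul_one]

theorem altSum_eq_of_apply_zero {c : X → F} {h : (Fin (k + 1) → X) → F} (hh : IsAltTail h)
    (ρ : Fin (k + 1) → Equiv.Perm (Fin (k + 1))) (hρ : ∀ i, ρ i 0 = i) (U : Fin (k + 1) → X) :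
    altSum c h U = ∑ i, c (U i) * (sgn F (ρ i) * h (U ∘ ρ i)) := by
  refine Finset.sum_congr rfl fun i _ => ?_
  rw [hh.sgn_mul_comp_eq (ρ' := ρ i)]
  rw [hρ, Fin.cycleRange_symm_zero]

theorem sgn_mul_comp_perm {h : (Fin (k + 1) → X) → F} (hh : IsAltTail h)
    (π : Equiv.Perm (Fin (k + 1))) (U : Fin (k + 1) → X) (i : Fin (k + 1)) :
    sgn F (Equiv.symm i.cycleRange) * h ((U ∘ π) ∘ Equiv.symm i.cycleRange) =
      sgn F π * (sgn F (Equiv.symm (π i).cycleRange) * h (U ∘ Equiv.symm (π i).cycleRange)) := by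
  rw [← hh.sgn_mul_comp_eq (ρ := π * Equiv.symm i.cycleRange)
    (by simp [Fin.cycleRange_symm_zero]) U]
  rw [sgn_mul, ← mul_assoc, ← mul_assoc, sgn_mul_self, one_mul]
  rfl

theorem altSum_comp_perm {c : X → F} {h : (Fin (k + 1) → X) → F} (hh : IsAltTail h)
    (π : Equiv.Perm (Fin (k + 1))) (U : Fin (k + 1) → X) :
    altSum c h (U ∘ π) = sgn F π * altSum c h U := by
  unfold altSum
  rw [Finset.mul_sum, ← Equiv.sum_comp π
    (fun i => sgn F π * (c (U i) * (sgn F (Equiv.symm i.cycleRange) *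
      h (U ∘ Equiv.symm i.cycleRange))))]
  refine Finset.sum_congr rfl fun i _ => ?_
  rw [sgn_mul_comp_perm hh, Function.comp_apply]
  ring

theorem altSum_eq_zero_of_not_injective {c : X → F} {h : (Fin (k + 1) → X) → F}
    (hh : IsAltTail h) {U : Fin (k + 1) → X} (hU : ¬ Function.Injective U) :
    altSum c h U = 0 := by
  simp only [Function.Injective, not_forall] at hU
  obtain ⟨p, q, hpq, hne⟩ := hU
  have hswap : U ∘ Equiv.swap p q = U := by
    funext j
    simp only [Function.comp_apply, Equiv.swap_apply_def]
    split_ifs <;> simp_all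
  refine Finset.sum_involution (fun i _ => Equiv.swap p q i) ?_ ?_ (by simp) (by simp)
  · intro i _
    have h1 := sgn_mul_comp_perm hh (Equiv.swap p q) U i
    rw [hswap, sgn_swap hne] at h1
    have h2 : U (Equiv.swap p q i) = U i := congrFun hswap i
    rw [h1, h2]
    ring
  · intro i _ hi hfix
    apply hi
    rw [hh.2, mul_zero, mul_zero]
    intro hinj
    have hip : i ≠ p := by rintro rfl; rw [Equiv.swap_apply_left] at hfix; exact hne hfix.symm
    have hiq : i ≠ q := by rintro rfl; rw [Equiv.swap_apply_right] at hfix; exact hne hfix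
    obtain ⟨p', rfl⟩ := Fin.exists_succAbove_eq hip.symm
    obtain ⟨q', rfl⟩ := Fin.exists_succAbove_eq hiq.symm
    have : p' = q' := hinj (by simpa [Fin.cycleRange_symm_succ] using hpq)
    exact hne (by rw [this])

end AltSum

section Homogeneous

variable {n : ℕ} {k : ℕ}

/-- The differences of the last `k` coordinates with the first one. -/
def diff (U : Fin (k + 1) → ZMod n) : Fin k → ZMod n :=
  fun j => U j.succ - U 0

/-- The homogeneous coordinates `(0, u_1, …, u_k)` of `u`. -/
def hom (u : Fin k → ZMod n) : Fin (k + 1) → ZMod n :=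
  Fin.cons 0 u

theorem diff_hom (u : Fin k → ZMod n) : diff (hom u) = u := by
  funext j; simp [diff, hom]

theorem hom_diff (U : Fin (k + 1) → ZMod n) : hom (diff U) = fun i => U i - U 0 := by
  funext i
  refine Fin.cases ?_ (fun j => ?_) i <;> simp [diff, hom]

theorem diff_sub_const (U : Fin (k + 1) → ZMod n) (c : ZMod n) :
    diff (fun i => U i - c) = diff U := by
  funext j; simp [diff]

theorem diff_hom_diff_comp (U : Fin (k + 1) → ZMod n) (ρ : Equiv.Perm (Fin (k + 1))) :
    diff (hom (diff U) ∘ ρ) = diff (U ∘ ρ) := by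
  rw [hom_diff]
  exact diff_sub_const (U ∘ ρ) (U 0)

theorem Ttrans_eq_diff (u : Fin k → ZMod n) :
    Ttrans n k u = diff (hom u ∘ finRotate (k + 1)) := by
  funext i
  have hk : 0 < k := i.pos
  obtain ⟨m, rfl⟩ : ∃ m, k = m + 1 := ⟨k - 1, by omega⟩
  have h0 : hom u (finRotate (m + 1 + 1) 0) = u 0 := by
    rw [finRotate_apply, zero_add, show (1 : Fin (m + 2)) = Fin.succ 0 from rfl]
    simp [hom]
  have h1 : hom u (finRotate (m + 1 + 1) i.succ)
      = if h : (i : ℕ) + 1 < m + 1 then u ⟨(i : ℕ) + 1, h⟩ else 0 := by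
    rw [finRotate_apply]
    split_ifs with h
    · have : i.succ + 1 = Fin.succ (⟨(i : ℕ) + 1, h⟩ : Fin (m + 1)) := by
        ext
        rw [Fin.val_add_one_of_lt]
        · simp
        · simp [Fin.lt_def]; omega
      rw [this, hom, Fin.cons_succ]
    · have : i = Fin.last m := by ext; simp; omega
      subst this
      simp [hom]
  simp only [Ttrans, diff, Function.comp_apply, h0, h1]
  rfl

theorem Ttrans_diff (U : Fin (k + 1) → ZMod n) :
    Ttrans n k (diff U) = diff (U ∘ finRotate (k + 1)) := by
  rw [Ttrans_eq_diff, diff_hom_diff_comp]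

theorem Ttrans_iterate (u : Fin k → ZMod n) (m : ℕ) :
    (Ttrans n k)^[m] u = diff (hom u ∘ (finRotate (k + 1) ^ m : Equiv.Perm (Fin (k + 1)))) := by
  induction m with
  | zero => exact (diff_hom u).symm
  | succ m ih =>
    rw [Function.iterate_succ_apply', ih, Ttrans_diff, pow_succ]
    rfl

theorem diff_mem_Dset_iff (U : Fin (k + 1) → ZMod n) :
    diff U ∈ Dset n k ↔ Function.Injective U := by
  constructor
  · rintro ⟨h0, hinj⟩ i j
    refine Fin.cases ?_ (fun i => ?_) i <;> refine Fin.cases ?_ (fun j => ?_) j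
    · simp
    · intro h; exact absurd (by simp [diff, h]) (h0 j)
    · intro h; exact absurd (by simp [diff, h]) (h0 i)
    · intro h; rw [hinj (by simp [diff, h] : diff U i = diff U j)]
  · intro h
    refine ⟨fun i hi => ?_, fun i j hij => ?_⟩
    · exact Fin.succ_ne_zero i (h (sub_eq_zero.1 hi))
    · exact Fin.succ_injective _ (h (sub_left_injective hij))

theorem mem_Dset_iff (u : Fin k → ZMod n) : u ∈ Dset n k ↔ Function.Injective (hom u) := by
  rw [← diff_mem_Dset_iff, diff_hom]

theorem Eset_subset_Dset {u : Fin k → ZMod n} (hu : u ∈ Dset n k) :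
    Eset n k u ⊆ Dset n k := by
  rintro v ⟨i, -, rfl⟩
  rw [Ttrans_iterate, diff_mem_Dset_iff]
  exact ((mem_Dset_iff u).1 hu).comp (Equiv.injective _)

theorem exists_hom_comp_perm (u : Fin k → ZMod n) (σ : Equiv.Perm (Fin k)) (F : Type*) [Field F] :
    ∃ τ : Equiv.Perm (Fin (k + 1)), sgn F τ = sgn F σ ∧ τ 0 = 0 ∧ hom (u ∘ σ) = hom u ∘ τ := by
  obtain ⟨τ, hs, h0, hτ⟩ := exists_perm_extending (R := F) σ
  refine ⟨τ, hs, h0, ?_⟩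
  funext i
  refine Fin.cases ?_ (fun j => ?_) i
  · simp [hom, h0]
  · simp [hom, hτ]

theorem diff_comp_perm {τ : Equiv.Perm (Fin (k + 1))} (h0 : τ 0 = 0) {σ : Equiv.Perm (Fin k)}
    (hτ : ∀ j : Fin k, τ j.succ = (σ j).succ) (U : Fin (k + 1) → ZMod n) :
    diff (U ∘ τ) = diff U ∘ σ := by
  funext j; simp [diff, h0, hτ]

end Homogeneous

section AlternatingFunctions

variable {n : ℕ} [NeZero n] {F : Type*} [Field F] {k : ℕ}

theorem isAlt_apply_comp {φ : (Fin k → ZMod n) → F} (hφ : IsAlt n F k φ)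
    (π : Equiv.Perm (Fin k)) (v : Fin k → ZMod n) : φ (v ∘ π) = sgn F π * φ v := by
  rw [hφ.1, zsmul_eq_mul, sgn]

theorem isAlt_of_apply_comp {φ : (Fin k → ZMod n) → F}
    (h1 : ∀ (π : Equiv.Perm (Fin k)) (v : Fin k → ZMod n), φ (v ∘ π) = sgn F π * φ v)
    (h2 : ∀ v : Fin k → ZMod n, ¬ Function.Injective v → φ v = 0) : IsAlt n F k φ :=
  ⟨fun π v => by rw [h1, zsmul_eq_mul, sgn], h2⟩

theorem isAltTail_tail {φ : (Fin k → ZMod n) → F} (hφ : IsAlt n F k φ) :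
    IsAltTail (fun U : Fin (k + 1) → ZMod n => φ (U ∘ Fin.succ)) := by
  refine ⟨fun τ h0 U => ?_, fun U hU => hφ.2 _ hU⟩
  obtain ⟨π, hs, hπ⟩ := exists_perm_of_apply_zero_eq_zero (R := F) h0
  rw [← hs, ← isAlt_apply_comp hφ]
  refine congrArg φ ?_
  funext j; simp [hπ]

theorem isAltTail_diff {φ : (Fin k → ZMod n) → F} (hφ : IsAlt n F k φ) :
    IsAltTail (fun U : Fin (k + 1) → ZMod n => φ (diff U)) := by
  refine ⟨fun τ h0 U => ?_, fun U hU => hφ.2 _ fun h => hU fun i j hij => h ?_⟩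
  · obtain ⟨π, hs, hπ⟩ := exists_perm_of_apply_zero_eq_zero (R := F) h0
    beta_reduce
    rw [← hs, ← isAlt_apply_comp hφ, diff_comp_perm h0 hπ]
  · exact congrArg (· - U 0) hij

end AlternatingFunctions

section Coboundary

variable {n : ℕ} {F : Type*} [Field F] {ω : F} {k : ℕ}

theorem sum_cons {X M : Type*} [Fintype X] [AddCommMonoid M] (f : (Fin (k + 1) → X) → M) :
    ∑ v, f v = ∑ y : Fin k → X, ∑ t : X, f (Fin.cons t y) := by
  rw [← Equiv.sum_comp (Fin.consEquiv (fun _ => X)) f, Fintype.sum_prod_type_right]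
  rfl

theorem sum_comp_perm {X M : Type*} [Fintype X] [AddCommMonoid M] (ρ : Equiv.Perm (Fin k))
    (f : (Fin k → X) → M) : ∑ v : Fin k → X, f (v ∘ ρ) = ∑ v, f v := by
  rw [← Equiv.sum_comp (Equiv.arrowCongr ρ.symm (Equiv.refl X)) f]
  rfl

theorem sum_mul_eq_sum_comp {R : Type*} [CommRing R] (U v : Fin k → R) (ρ : Equiv.Perm (Fin k)) :
    ∑ j, U j * v j = ∑ j, (U ∘ ρ) j * (v ∘ ρ) j :=
  (Equiv.sum_comp ρ (fun j => U j * v j)).symm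

/-- The simplicial coboundary of a function of `k` variables. -/
def coboundary (φ : (Fin k → ZMod n) → F) : (Fin (k + 1) → ZMod n) → F :=
  altSum (fun _ => 1) (fun U => φ (U ∘ Fin.succ))

theorem coboundary_apply (φ : (Fin k → ZMod n) → F) (v : Fin (k + 1) → ZMod n) :
    coboundary φ v = ∑ i : Fin (k + 1), (-1 : F) ^ (i : ℕ) * φ (fun j => v (i.succAbove j)) := by
  unfold coboundary altSum
  refine Finset.sum_congr rfl fun i _ => ?_
  rw [one_mul, sgn_cycleRange_symm]
  refine congrArg (fun w => (-1) ^ (i : ℕ) * φ w) ?_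
  funext j
  simp [Fin.cycleRange_symm_succ]

theorem sgn_ne_zero (π : Equiv.Perm (Fin k)) : sgn F π ≠ 0 := by
  intro h
  have := sgn_mul_self (R := F) π
  simp [h] at this

variable [NeZero n]

theorem sum_tail_hyperplane (hω : IsPrimitiveRoot ω n) (φ : (Fin k → ZMod n) → F) (a : ZMod n)
    (U : Fin (k + 1) → ZMod n) :
    ∑ v : Fin (k + 1) → ZMod n, (if ∑ i, v i = a then φ (v ∘ Fin.succ) else 0) *
      eF n F ω (-(∑ j, U j * v j)) =
    eF n F ω (-(U 0 * a)) * fourierT n F ω k φ (diff U) := by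
  rw [sum_cons, fourierT, Finset.mul_sum]
  refine Finset.sum_congr rfl fun y _ => ?_
  rw [Finset.sum_eq_single (a - ∑ j, y j)]
  · have h1 : (Fin.cons (a - ∑ j, y j) y : Fin (k + 1) → ZMod n) ∘ Fin.succ = y := by
      funext j; simp
    rw [h1, if_pos (by simp [Fin.sum_univ_succ]), mul_left_comm, ← eF_add hω]
    congr 2
    simp only [Fin.sum_univ_succ, Fin.cons_zero, Fin.cons_succ, diff, sub_mul,
      Finset.sum_sub_distrib, ← Finset.mul_sum]
    ring
  · intro t _ ht
    rw [if_neg, zero_mul]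
    intro h
    rw [Fin.sum_univ_succ] at h
    simp only [Fin.cons_zero, Fin.cons_succ] at h
    exact ht (eq_sub_of_add_eq h)
  · simp

theorem sum_tail (hω : IsPrimitiveRoot ω n) (ψ : (Fin k → ZMod n) → F)
    (U : Fin (k + 1) → ZMod n) :
    ∑ v : Fin (k + 1) → ZMod n, ψ (v ∘ Fin.succ) * eF n F ω (-(∑ j, U j * v j)) =
      (if U 0 = 0 then (n : F) else 0) * fourierT n F ω k ψ (U ∘ Fin.succ) := by
  rw [sum_cons, fourierT, ← sum_eF_neg_mul hω, Finset.mul_sum]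
  refine Finset.sum_congr rfl fun y _ => ?_
  rw [Finset.sum_mul]
  refine Finset.sum_congr rfl fun t _ => ?_
  have h1 : (Fin.cons t y : Fin (k + 1) → ZMod n) ∘ Fin.succ = y := by
    funext j; simp
  rw [h1, mul_left_comm, ← eF_add hω]
  congr 2
  simp only [Fin.sum_univ_succ, Fin.cons_zero, Fin.cons_succ, Function.comp_apply]
  ring

theorem isAlt_coboundary {φ : (Fin k → ZMod n) → F} (hφ : IsAlt n F k φ) :
    IsAlt n F (k + 1) (coboundary φ) :=
  isAlt_of_apply_comp (fun π v => altSum_comp_perm (isAltTail_tail hφ) π v)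
    fun _ hv => altSum_eq_zero_of_not_injective (isAltTail_tail hφ) hv

theorem fourierT_coboundary (hω : IsPrimitiveRoot ω n) (ψ : (Fin k → ZMod n) → F) :
    fourierT n F ω (k + 1) (coboundary ψ) =
      altSum (fun x => if x = 0 then (n : F) else 0)
        (fun U => fourierT n F ω k ψ (U ∘ Fin.succ)) := by
  funext U
  simp only [fourierT.eq_def n F ω (k + 1), coboundary, altSum, Finset.sum_mul, one_mul]
  rw [Finset.sum_comm]
  refine Finset.sum_congr rfl fun i _ => ?_
  have h1 := sum_tail hω ψ (U ∘ Equiv.symm i.cycleRange)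
  rw [Function.comp_apply, Fin.cycleRange_symm_zero] at h1
  rw [mul_left_comm, ← h1, Finset.mul_sum]
  refine Eq.trans (Finset.sum_congr rfl fun v _ => ?_) (sum_comp_perm (Equiv.symm i.cycleRange) _)
  rw [mul_assoc, ← sum_mul_eq_sum_comp]

/-- The Fourier side of the cocycle condition on the hyperplane `∑ v = a`. -/
noncomputable def twistedSum (ω : F) (a : ZMod n) (g : (Fin k → ZMod n) → F) : (Fin (k + 1) → ZMod n) → F :=
  altSum (fun x => eF n F ω (-(x * a))) (fun U => g (diff U))

theorem fourierT_coboundary_hyperplane (hω : IsPrimitiveRoot ω n) (φ : (Fin k → ZMod n) → F)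
    (a : ZMod n) :
    fourierT n F ω (k + 1) (fun v => if ∑ i, v i = a then coboundary φ v else 0) =
      twistedSum ω a (fourierT n F ω k φ) := by
  funext U
  have h0 : ∀ v : Fin (k + 1) → ZMod n, (if ∑ i, v i = a then coboundary φ v else 0) =
      ∑ i : Fin (k + 1), sgn F (Equiv.symm i.cycleRange) *
        (if ∑ j, (v ∘ Equiv.symm i.cycleRange) j = a
          then φ ((v ∘ Equiv.symm i.cycleRange) ∘ Fin.succ) else 0) := by
    intro v
    have : ∀ i : Fin (k + 1), ∑ j, (v ∘ Equiv.symm i.cycleRange) j = ∑ j, v j := fun i =>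
      Equiv.sum_comp (Equiv.symm i.cycleRange) v
    simp only [this]
    split_ifs <;> simp [coboundary, altSum]
  simp only [fourierT.eq_def n F ω (k + 1), h0, twistedSum, altSum, Finset.sum_mul]
  rw [Finset.sum_comm]
  refine Finset.sum_congr rfl fun i _ => ?_
  have h1 := sum_tail_hyperplane hω φ a (U ∘ Equiv.symm i.cycleRange)
  rw [Function.comp_apply, Fin.cycleRange_symm_zero] at h1
  rw [mul_left_comm, ← h1, Finset.mul_sum]
  refine Eq.trans (Finset.sum_congr rfl fun v _ => ?_) (sum_comp_perm (Equiv.symm i.cycleRange) _)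
  rw [mul_assoc, ← sum_mul_eq_sum_comp]

theorem twistedSum_comp_perm {g : (Fin k → ZMod n) → F} (hg : IsAlt n F k g) (a : ZMod n)
    (π : Equiv.Perm (Fin (k + 1))) (U : Fin (k + 1) → ZMod n) :
    twistedSum ω a g (U ∘ π) = sgn F π * twistedSum ω a g U :=
  altSum_comp_perm (isAltTail_diff hg) π U

theorem twistedSum_sub_const (hω : IsPrimitiveRoot ω n) (g : (Fin k → ZMod n) → F) (a c : ZMod n)
    (U : Fin (k + 1) → ZMod n) :
    twistedSum ω a g (fun i => U i - c) = eF n F ω (c * a) * twistedSum ω a g U := by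
  simp only [twistedSum, altSum, Finset.mul_sum]
  refine Finset.sum_congr rfl fun i _ => ?_
  rw [← mul_assoc (eF n F ω (c * a)), ← eF_add hω]
  congr 2
  · ring_nf
  · exact congrArg g (diff_sub_const (U ∘ Equiv.symm i.cycleRange) c)

theorem twistedSum_hom_diff_eq_zero_iff (hω : IsPrimitiveRoot ω n) (g : (Fin k → ZMod n) → F)
    (a : ZMod n) (U : Fin (k + 1) → ZMod n) :
    twistedSum ω a g (hom (diff U)) = 0 ↔ twistedSum ω a g U = 0 := by
  rw [hom_diff, twistedSum_sub_const hω, mul_eq_zero, or_iff_right (eF_ne_zero hω _)]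

theorem twistedSum_hom (u : Fin k → ZMod n) {g : (Fin k → ZMod n) → F} (hg : IsAlt n F k g)
    (a : ZMod n) :
    twistedSum ω a g (hom u) = g u + ∑ i : Fin k, (-1 : F) ^ (k * ((i : ℕ) + 1)) *
      eF n F ω (-(u i * a)) * g ((Ttrans n k)^[(i : ℕ) + 1] u) := by
  rw [twistedSum, altSum_eq_of_apply_zero (isAltTail_diff hg)
    (fun i => finRotate (k + 1) ^ (i : ℕ)) finRotate_pow_apply_zero, Fin.sum_univ_succ]
  simp only [← Ttrans_iterate, sgn_finRotate_pow]
  congr 1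
  · simp [hom, eF_zero]
  · refine Finset.sum_congr rfl fun i _ => ?_
    simp only [hom, Fin.cons_succ, Fin.val_succ]
    ring

/-- An alternating function is a cocycle exactly when all the twisted sums of its Fourier
transform vanish. -/
theorem mem_Zset_iff (hchar : ¬ ringChar F ∣ n) (hω : IsPrimitiveRoot ω n) (A : Finset (ZMod n))
    (φ : (Fin k → ZMod n) → F) :
    φ ∈ Zset n F k A ↔ IsAlt n F k φ ∧
      ∀ a ∈ A, ∀ U, twistedSum ω a (fourierT n F ω k φ) U = 0 := by
  refine and_congr_right fun hφ => ?_
  simp only [← coboundary_apply]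
  constructor
  · intro h a ha U
    rw [← fourierT_coboundary_hyperplane hω]
    refine Finset.sum_eq_zero fun v _ => ?_
    rw [mul_eq_zero]
    left
    beta_reduce
    split_ifs with hv
    · by_cases hinj : Function.Injective v
      · exact h v hinj (hv ▸ ha)
      · exact (isAlt_coboundary hφ).2 v hinj
    · rfl
  · intro h v _ hv
    have h2 := fourierT_injective hchar hω (k := k + 1)
      (a₁ := fun w => if ∑ i, w i = ∑ i, v i then coboundary φ w else 0) (a₂ := fun _ => 0) (by
        rw [fourierT_coboundary_hyperplane hω]
        funext U
        rw [h _ hv U]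
        simp [fourierT])
    simpa using congrFun h2 v

theorem twistedSum_eq_zero_of_forall_Dset {g : (Fin k → ZMod n) → F} (hg : IsAlt n F k g)
    (h : ∀ u ∈ Dset n k, g u = 0) (a : ZMod n) (U : Fin (k + 1) → ZMod n) :
    twistedSum ω a g U = 0 := by
  by_cases hU : Function.Injective U
  · unfold twistedSum altSum
    refine Finset.sum_eq_zero fun i _ => ?_
    beta_reduce
    rw [h _ ((diff_mem_Dset_iff _).2 (hU.comp (Equiv.injective _))), mul_zero, mul_zero]
  · exact altSum_eq_zero_of_not_injective (isAltTail_diff hg) hU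

/-- Coboundaries are the alternating functions whose Fourier transform vanishes on `D_{n,k}`. -/
theorem mem_Bset_iff (hk : 0 < k) (hchar : ¬ ringChar F ∣ n) (hω : IsPrimitiveRoot ω n)
    (φ : (Fin k → ZMod n) → F) :
    φ ∈ Bset n F k ↔ IsAlt n F k φ ∧ ∀ u ∈ Dset n k, fourierT n F ω k φ u = 0 := by
  obtain ⟨m, rfl⟩ : ∃ m, k = m + 1 := ⟨k - 1, by omega⟩
  have hdel : ∀ (i : Fin (m + 1)) (v : Fin (m + 1) → ZMod n),
      delCoord n i v = fun j : Fin m => v (i.succAbove j) := by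
    intro i v
    funext j
    unfold delCoord
    split_ifs with h
    · rw [Fin.succAbove_of_castSucc_lt _ _ (by simpa [Fin.lt_def] using h)]; rfl
    · rw [Fin.succAbove_of_le_castSucc _ _ (by simpa [Fin.le_def] using h)]; rfl
  have hB : φ ∈ Bset n F (m + 1) ↔ ∃ ψ : (Fin m → ZMod n) → F, IsAlt n F m ψ ∧
      φ = coboundary ψ := by
    refine exists_congr fun ψ => and_congr_right fun _ => ?_
    rw [show coboundary ψ = _ from funext (coboundary_apply ψ)]
    simp only [hdel]
    rfl
  rw [hB]
  constructor
  · rintro ⟨ψ, hψ, rfl⟩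
    refine ⟨isAlt_coboundary hψ, fun u hu => ?_⟩
    rw [fourierT_coboundary hω]
    exact Finset.sum_eq_zero fun i _ => by simp only [if_neg (hu.1 i), zero_mul]
  · rintro ⟨hφ, h0⟩
    have hn := natCast_ne_zero_of_not_ringChar_dvd hchar
    let ψ : (Fin m → ZMod n) → F := fun y => (n : F)⁻¹ * ∑ t, φ (Fin.cons t y)
    have hψ : IsAlt n F m ψ := by
      refine isAlt_of_apply_comp (fun π y => ?_) (fun y hy => ?_)
      · obtain ⟨τ, hs, hτ0, hτ⟩ := exists_perm_extending (R := F) π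
        have h1 : ∀ t, (Fin.cons t (y ∘ π) : Fin (m + 1) → ZMod n) = Fin.cons t y ∘ τ := by
          intro t
          funext i
          refine Fin.cases ?_ (fun j => ?_) i
          · simp [hτ0]
          · simp [hτ]
        simp only [ψ, h1, isAlt_apply_comp hφ, hs, ← Finset.mul_sum]
        ring
      · have h1 : ∀ t, φ (Fin.cons t y) = 0 := fun t => hφ.2 _ fun h => hy fun i j hij =>
          Fin.succ_injective _ (h (by simpa using hij))
        simp [ψ, h1]
    have hψhat : ∀ w, (n : F) * fourierT n F ω m ψ w = fourierT n F ω (m + 1) φ (Fin.cons 0 w) := by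
      intro w
      rw [fourierT, fourierT, sum_cons, Finset.mul_sum]
      refine Finset.sum_congr rfl fun y _ => ?_
      simp only [ψ, Fin.sum_univ_succ, Fin.cons_zero, Fin.cons_succ, zero_mul, zero_add]
      rw [← Finset.sum_mul, ← mul_assoc, ← mul_assoc, mul_inv_cancel₀ hn, one_mul]
    refine ⟨ψ, hψ, fourierT_injective hchar hω ?_⟩
    have hφhat := isAlt_fourierT (ω := ω) hφ
    funext u
    by_cases hinj : Function.Injective u
    · by_cases hu : u ∈ Dset n (m + 1)
      · rw [h0 u hu, fourierT_coboundary hω]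
        exact (Finset.sum_eq_zero fun i _ => by simp only [if_neg (hu.1 i), zero_mul]).symm
      · obtain ⟨p, hp⟩ : ∃ p, u p = 0 := by
          by_contra! h
          exact hu ⟨h, hinj⟩
        rw [fourierT_coboundary hω, altSum, Finset.sum_eq_single p]
        · rw [if_pos hp, mul_left_comm, hψhat]
          have h1 : (Fin.cons 0 ((u ∘ Equiv.symm p.cycleRange) ∘ Fin.succ) :
              Fin (m + 1) → ZMod n) = u ∘ Equiv.symm p.cycleRange := by
            funext i
            refine Fin.cases ?_ (fun j => ?_) i
            · simp [Fin.cycleRange_symm_zero, hp]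
            · simp
          rw [h1, isAlt_apply_comp hφhat, ← mul_assoc, sgn_mul_self, one_mul]
        · intro i _ hi
          rw [if_neg, zero_mul]
          intro h
          exact hi (hinj (h.trans hp.symm))
        · simp
    · rw [hφhat.2 u hinj, (isAlt_fourierT (isAlt_coboundary hψ)).2 u hinj]

end Coboundary

section Orbits

variable {n : ℕ} {F : Type*} [Field F] {ω : F} {k : ℕ}

/-- A predicate on homogeneous tuples that is insensitive to permutations and
translations is constant on the orbits. -/
theorem iff_of_eqvGen {P : (Fin (k + 1) → ZMod n) → Prop}
    (hperm : ∀ U (π : Equiv.Perm (Fin (k + 1))), P (U ∘ π) ↔ P U)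
    (htrans : ∀ U, P (hom (diff U)) ↔ P U) {u v : Fin k → ZMod n}
    (h : Relation.EqvGen (genRel n k) u v) : P (hom u) ↔ P (hom v) := by
  induction h with
  | rel u v h =>
    rcases h with rfl | ⟨σ, rfl⟩
    · rw [Ttrans_eq_diff, htrans, hperm]
    · obtain ⟨τ, -, -, hτ⟩ := exists_hom_comp_perm u σ ℚ
      rw [hτ, hperm]
  | refl u => rfl
  | symm u v _ ih => exact ih.symm
  | trans u v w _ _ ih1 ih2 => exact ih1.trans ih2

theorem eqvGen_Ttrans_iterate (u : Fin k → ZMod n) (m : ℕ) :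
    Relation.EqvGen (genRel n k) u ((Ttrans n k)^[m] u) := by
  induction m with
  | zero => exact Relation.EqvGen.refl _
  | succ m ih =>
    rw [Function.iterate_succ_apply']
    exact ih.trans _ _ _ (Relation.EqvGen.rel _ _ (Or.inl rfl))

/-- The symmetric group acts freely on the translation classes of injective tuples, since
`k + 1` is coprime to `n`. -/
theorem eq_of_diff_comp_eq (hcop : Nat.Coprime (k + 1) n) {U : Fin (k + 1) → ZMod n}
    (hU : Function.Injective U) {ρ ρ' : Equiv.Perm (Fin (k + 1))}
    (h : diff (U ∘ ρ) = diff (U ∘ ρ')) : ρ = ρ' := by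
  set c := U (ρ 0) - U (ρ' 0) with hc
  have h1 : ∀ i, U (ρ i) = U (ρ' i) + c := by
    intro i
    refine Fin.cases ?_ (fun j => ?_) i
    · rw [hc]; ring
    · have h2 := congrFun h j
      simp only [diff, Function.comp_apply] at h2
      rw [hc]
      linear_combination h2
  have h2 : ((k + 1 : ℕ) : ZMod n) * c = 0 := by
    have h3 : ∑ i, U (ρ i) = ∑ i, (U (ρ' i) + c) := Finset.sum_congr rfl fun i _ => h1 i
    rw [Finset.sum_add_distrib, Equiv.sum_comp ρ U, Equiv.sum_comp ρ' U] at h3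
    simpa using h3
  have h3 : c = 0 := ((ZMod.isUnit_iff_coprime (k + 1) n).2 hcop).mul_right_eq_zero.1 h2
  ext i
  have h4 := h1 i
  rw [h3, add_zero] at h4
  rw [hU h4]

theorem Ttrans_iterate_comp_perm_eq (hcop : Nat.Coprime (k + 1) n) {u : Fin k → ZMod n}
    (hu : u ∈ Dset n k) {i j : Fin (k + 1)} {σ : Equiv.Perm (Fin k)}
    (h : (Ttrans n k)^[(i : ℕ)] u ∘ σ = (Ttrans n k)^[(j : ℕ)] u) : i = j ∧ σ = 1 := by
  obtain ⟨τ, -, h0, hτ⟩ := exists_perm_extending (R := ℚ) σ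
  rw [Ttrans_iterate, Ttrans_iterate, ← diff_comp_perm h0 hτ] at h
  have h1 := eq_of_diff_comp_eq hcop ((mem_Dset_iff u).1 hu)
    (ρ := finRotate (k + 1) ^ (i : ℕ) * τ) (ρ' := finRotate (k + 1) ^ (j : ℕ)) h
  have hij : i = j := by
    have h2 := congrArg (fun ρ : Equiv.Perm (Fin (k + 1)) => ρ 0) h1
    simpa only [Equiv.Perm.mul_apply, h0, finRotate_pow_apply_zero] using h2
  subst hij
  have h3 : τ = 1 := mul_eq_left.1 h1
  refine ⟨rfl, ?_⟩
  ext1 j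
  have h4 := hτ j
  rw [h3] at h4
  exact Fin.succ_injective _ h4.symm

open Classical in
/-- The alternating function supported on `D_{n,k}` that restricts to the given functions on
the sets `E_u`, `u ∈ R`. -/
noncomputable def glue (R : Finset (Fin k → ZMod n))
    (g : (u : {u // u ∈ R}) → (↥(Eset n k u.1) → F)) (v : Fin k → ZMod n) : F :=
  ∑ u : {u // u ∈ R}, ∑ i : Fin (k + 1), ∑ σ : Equiv.Perm (Fin k),
    if (Ttrans n k)^[(i : ℕ)] u.1 ∘ σ = v then
      sgn F σ * g u ⟨(Ttrans n k)^[(i : ℕ)] u.1, (i : ℕ), i.is_le, rfl⟩ else 0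

theorem glue_eq_zero {R : Finset (Fin k → ZMod n)} (hR1 : ↑R ⊆ Dset n k)
    (g : (u : {u // u ∈ R}) → (↥(Eset n k u.1) → F)) {v : Fin k → ZMod n}
    (hv : ¬ Function.Injective v) : glue R g v = 0 := by
  refine Finset.sum_eq_zero fun u _ => Finset.sum_eq_zero fun i _ =>
    Finset.sum_eq_zero fun σ _ => if_neg ?_
  rintro rfl
  exact hv ((Eset_subset_Dset (hR1 u.2) ⟨i, i.is_le, rfl⟩).2.comp σ.injective)

theorem glue_apply (hcop : Nat.Coprime (k + 1) n) {R : Finset (Fin k → ZMod n)}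
    (hR1 : ↑R ⊆ Dset n k)
    (hR2 : ∀ v ∈ Dset n k, ∃! u, u ∈ R ∧ Relation.EqvGen (genRel n k) u v)
    (g : (u : {u // u ∈ R}) → (↥(Eset n k u.1) → F)) (u : {u // u ∈ R})
    (v : ↥(Eset n k u.1)) : glue R g v.1 = g u v := by
  obtain ⟨_, j, hj, rfl⟩ := v
  obtain ⟨j, rfl⟩ : ∃ j' : Fin (k + 1), (j' : ℕ) = j := ⟨⟨j, by omega⟩, rfl⟩
  have key : ∀ (u' : {u // u ∈ R}) (i : Fin (k + 1)) (σ : Equiv.Perm (Fin k)),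
      (Ttrans n k)^[(i : ℕ)] u'.1 ∘ σ = (Ttrans n k)^[(j : ℕ)] u.1 → u' = u ∧ i = j ∧ σ = 1 := by
    intro u' i σ h
    have hu : u' = u := by
      have hD := Eset_subset_Dset (hR1 u.2) ⟨(j : ℕ), hj, rfl⟩
      refine Subtype.ext ((hR2 _ hD).unique ⟨u'.2, ?_⟩ ⟨u.2, eqvGen_Ttrans_iterate u.1 j⟩)
      rw [← h]
      exact (eqvGen_Ttrans_iterate u'.1 i).trans _ _ _ (Relation.EqvGen.rel _ _ (Or.inr ⟨σ, rfl⟩))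
    subst hu
    exact ⟨rfl, Ttrans_iterate_comp_perm_eq hcop (hR1 u'.2) h⟩
  unfold glue
  rw [Finset.sum_eq_single u, Finset.sum_eq_single j, Finset.sum_eq_single 1]
  · rw [if_pos (by simp), sgn_one, one_mul]
  · exact fun σ _ hσ => if_neg fun h => hσ (key _ _ _ h).2.2
  · simp
  · exact fun i _ hi => Finset.sum_eq_zero fun σ _ => if_neg fun h => hi (key _ _ _ h).2.1
  · simp
  · exact fun u' _ hu' => Finset.sum_eq_zero fun i _ => Finset.sum_eq_zero fun σ _ =>
      if_neg fun h => hu' (key _ _ _ h).1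
  · simp

variable [NeZero n]

/-- An alternating function vanishing on `E_u` vanishes on the whole orbit of `u`. -/
theorem eq_zero_of_eqvGen {g : (Fin k → ZMod n) → F} (hg : IsAlt n F k g)
    {u v : Fin k → ZMod n} (h0 : ∀ w ∈ Eset n k u, g w = 0)
    (h : Relation.EqvGen (genRel n k) u v) : g v = 0 := by
  have h1 := iff_of_eqvGen (P := fun U => ∀ ρ : Equiv.Perm (Fin (k + 1)), g (diff (U ∘ ρ)) = 0)
    (fun U π => ⟨fun H ρ => by
      simpa [Function.comp_assoc, ← Equiv.Perm.coe_mul] using H (π⁻¹ * ρ), fun H ρ => H (π * ρ)⟩)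
    (fun U => by simp only [diff_hom_diff_comp]) h
  have h2 := h1.1 (fun ρ => by
    have h3 := (isAltTail_diff hg).sgn_mul_comp_eq (ρ := ρ)
      (ρ' := finRotate (k + 1) ^ ((ρ 0 : Fin (k + 1)) : ℕ))
      (finRotate_pow_apply_zero (ρ 0)).symm (hom u)
    rw [← Ttrans_iterate, h0 _ ⟨_, Fin.is_le _, rfl⟩, mul_zero] at h3
    exact (mul_eq_zero.1 h3).resolve_left (sgn_ne_zero ρ)) 1
  rwa [Equiv.Perm.coe_one, Function.comp_id, diff_hom] at h2

theorem isAlt_glue {R : Finset (Fin k → ZMod n)} (hR1 : ↑R ⊆ Dset n k)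
    (g : (u : {u // u ∈ R}) → (↥(Eset n k u.1) → F)) : IsAlt n F k (glue R g) := by
  refine isAlt_of_apply_comp (fun π v => ?_) fun v hv => glue_eq_zero hR1 g hv
  unfold glue
  simp only [Finset.mul_sum]
  refine Finset.sum_congr rfl fun u _ => Finset.sum_congr rfl fun i _ => ?_
  rw [← Equiv.sum_comp (Equiv.mulRight π)]
  refine Finset.sum_congr rfl fun σ _ => ?_
  have h1 : (Ttrans n k)^[(i : ℕ)] u.1 ∘ (σ * π : Equiv.Perm (Fin k)) = v ∘ π ↔
      (Ttrans n k)^[(i : ℕ)] u.1 ∘ σ = v := by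
    rw [Equiv.Perm.coe_mul, ← Function.comp_assoc]
    exact π.surjective.injective_comp_right.eq_iff
  simp only [Equiv.coe_mulRight, h1, sgn_mul]
  split_ifs
  · ring
  · simp

theorem twistedSum_eq_zero_of_reps (hω : IsPrimitiveRoot ω n) {R : Finset (Fin k → ZMod n)}
    (hR2 : ∀ v ∈ Dset n k, ∃! u, u ∈ R ∧ Relation.EqvGen (genRel n k) u v)
    {g : (Fin k → ZMod n) → F} (hg : IsAlt n F k g) (a : ZMod n)
    (h : ∀ u ∈ R, twistedSum ω a g (hom u) = 0) (U : Fin (k + 1) → ZMod n) :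
    twistedSum ω a g U = 0 := by
  by_cases hU : Function.Injective U
  · obtain ⟨u, ⟨hu, huv⟩, -⟩ := hR2 _ ((diff_mem_Dset_iff U).2 hU)
    refine (twistedSum_hom_diff_eq_zero_iff hω g a U).1 ?_
    refine (iff_of_eqvGen (P := fun U => twistedSum ω a g U = 0) (fun U π => ?_)
      (twistedSum_hom_diff_eq_zero_iff hω g a) huv).1 (h u hu)
    rw [twistedSum_comp_perm hg, mul_eq_zero, or_iff_right (sgn_ne_zero π)]
  · exact altSum_eq_zero_of_not_injective (isAltTail_diff hg) hU

theorem restrict_mem_Lsub_iff (A : Finset (ZMod n)) (u : Fin k → ZMod n)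
    {g : (Fin k → ZMod n) → F} (hg : IsAlt n F k g) :
    (fun v : ↥(Eset n k u) => g v.1) ∈ Lsub n F ω k A u ↔
      ∀ a ∈ A, twistedSum ω a g (hom u) = 0 := by
  simp only [twistedSum_hom u hg]
  rfl

theorem exists_mem_Zset_restrict_eq (hcop : Nat.Coprime (k + 1) n) (hchar : ¬ ringChar F ∣ n)
    (hω : IsPrimitiveRoot ω n) (A : Finset (ZMod n)) {R : Finset (Fin k → ZMod n)}
    (hR1 : ↑R ⊆ Dset n k)
    (hR2 : ∀ v ∈ Dset n k, ∃! u, u ∈ R ∧ Relation.EqvGen (genRel n k) u v)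
    (g : (u : {u // u ∈ R}) → (↥(Eset n k u.1) → F))
    (hg : ∀ u : {u // u ∈ R}, g u ∈ Lsub n F ω k A u.1) :
    ∃ φ ∈ Zset n F k A, ∀ (u : {u // u ∈ R}) (v : ↥(Eset n k u.1)),
      fourierT n F ω k φ v.1 = g u v := by
  have hG := isAlt_glue hR1 g
  have hGg := glue_apply hcop hR1 hR2 g
  obtain ⟨φ, hφ, hφG⟩ := exists_fourierT_eq hchar hω hG
  refine ⟨φ, (mem_Zset_iff hchar hω A φ).2 ⟨hφ, fun a ha => ?_⟩, fun u v => by rw [hφG, hGg]⟩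
  rw [hφG]
  refine twistedSum_eq_zero_of_reps hω hR2 hG a fun u hu => ?_
  refine (restrict_mem_Lsub_iff A u hG).1 ?_ a ha
  rw [funext (hGg ⟨u, hu⟩)]
  exact hg ⟨u, hu⟩

theorem forall_Eset_eq_zero_iff (hk : 0 < k) (hchar : ¬ ringChar F ∣ n)
    (hω : IsPrimitiveRoot ω n) {R : Finset (Fin k → ZMod n)} (hR1 : ↑R ⊆ Dset n k)
    (hR2 : ∀ v ∈ Dset n k, ∃! u, u ∈ R ∧ Relation.EqvGen (genRel n k) u v)
    {φ : (Fin k → ZMod n) → F} (hφ : IsAlt n F k φ) :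
    (∀ u ∈ R, ∀ v ∈ Eset n k u, fourierT n F ω k φ v = 0) ↔ φ ∈ Bset n F k := by
  rw [mem_Bset_iff hk hchar hω, and_iff_right hφ]
  refine ⟨fun h v hv => ?_, fun h u hu v hv => h v (Eset_subset_Dset (hR1 hu) hv)⟩
  obtain ⟨u, ⟨hu, huv⟩, -⟩ := hR2 v hv
  exact eq_zero_of_eqvGen (isAlt_fourierT hφ) (h u hu) huv

end Orbits

section Dimension

variable (n : ℕ) [NeZero n] (F : Type*) [Field F] (ω : F) (k : ℕ)

/-- The Fourier transform as a linear map. -/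
noncomputable def fourierLinear : ((Fin k → ZMod n) → F) →ₗ[F] ((Fin k → ZMod n) → F) where
  toFun := fourierT n F ω k
  map_add' f g := by
    funext u
    simp [fourierT, add_mul, Finset.sum_add_distrib]
  map_smul' c f := by
    funext u
    simp [fourierT, mul_assoc, Finset.mul_sum]

/-- The space of alternating functions. -/
def altSubmodule : Submodule F ((Fin k → ZMod n) → F) where
  carrier := {φ | IsAlt n F k φ}
  add_mem' {f g} hf hg :=
    ⟨fun π v => by simp [hf.1 π v, hg.1 π v], fun v hv => by simp [hf.2 v hv, hg.2 v hv]⟩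
  zero_mem' := ⟨fun π v => by simp, fun v _ => rfl⟩
  smul_mem' c f hf :=
    ⟨fun π v => by simp [hf.1 π v, mul_left_comm], fun v hv => by simp [hf.2 v hv]⟩

/-- The space of cocycles as a submodule. -/
def cocycles (A : Finset (ZMod n)) : Submodule F ((Fin k → ZMod n) → F) where
  carrier := Zset n F k A
  add_mem' {f g} hf hg := ⟨(altSubmodule n F k).add_mem hf.1 hg.1, fun v hv ha => by
    simp only [Pi.add_apply, mul_add, Finset.sum_add_distrib, hf.2 v hv ha, hg.2 v hv ha, add_zero]⟩
  zero_mem' := ⟨(altSubmodule n F k).zero_mem, fun v _ _ => by simp⟩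
  smul_mem' c f hf := ⟨(altSubmodule n F k).smul_mem c hf.1, fun v hv ha => by
    simp only [Pi.smul_apply, smul_eq_mul, mul_left_comm _ c, ← Finset.mul_sum, hf.2 v hv ha,
      mul_zero]⟩

/-- The space `L_u` as a submodule. -/
def Lsubmodule (A : Finset (ZMod n)) (u : Fin k → ZMod n) :
    Submodule F (↥(Eset n k u) → F) where
  carrier := Lsub n F ω k A u
  add_mem' {f g} hf hg a ha := by
    refine Eq.trans ?_ ((congrArg₂ (· + ·) (hf a ha) (hg a ha)).trans (add_zero 0))
    rw [add_add_add_comm, ← Finset.sum_add_distrib]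
    exact congrArg _ (Finset.sum_congr rfl fun i _ => mul_add _ _ _)
  zero_mem' a _ := by simp
  smul_mem' c f hf a ha := by
    simp only [Pi.smul_apply, smul_eq_mul, mul_left_comm _ c, ← Finset.mul_sum, ← mul_add,
      hf a ha, mul_zero]

variable {n F ω k}

/-- The map `Θ` from cocycles to the product of the spaces `L_u`. -/
noncomputable def theta (hchar : ¬ ringChar F ∣ n) (hω : IsPrimitiveRoot ω n)
    (A : Finset (ZMod n)) (R : Finset (Fin k → ZMod n)) :
    cocycles n F k A →ₗ[F] ((u : {u // u ∈ R}) → Lsubmodule n F ω k A u.1) :=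
  LinearMap.pi fun u => LinearMap.codRestrict (Lsubmodule n F ω k A u.1)
    (LinearMap.funLeft F F Subtype.val ∘ₗ fourierLinear n F ω k ∘ₗ (cocycles n F k A).subtype)
    fun φ => (restrict_mem_Lsub_iff A u.1 (isAlt_fourierT φ.2.1)).2 fun a ha =>
      ((mem_Zset_iff hchar hω A φ.1).1 φ.2).2 a ha _

theorem Bset_subset_Zset (hk : 0 < k) (hchar : ¬ ringChar F ∣ n) (hω : IsPrimitiveRoot ω n)
    (A : Finset (ZMod n)) : Bset n F k ⊆ Zset n F k A := by
  intro φ hφ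
  rw [mem_Bset_iff hk hchar hω] at hφ
  exact (mem_Zset_iff hchar hω A φ).2 ⟨hφ.1, fun a _ =>
    twistedSum_eq_zero_of_forall_Dset (isAlt_fourierT hφ.1) hφ.2 a⟩

theorem set_finrank_coe {V : Type*} [AddCommGroup V] [Module F V] (W : Submodule F V) :
    Set.finrank F (W : Set V) = Module.finrank F W := by
  rw [Set.finrank, Submodule.span_eq]

theorem finrank_Zset (hk : 0 < k) (hcop : Nat.Coprime (k + 1) n) (hchar : ¬ ringChar F ∣ n)
    (hω : IsPrimitiveRoot ω n) (A : Finset (ZMod n)) {R : Finset (Fin k → ZMod n)}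
    (hR1 : ↑R ⊆ Dset n k)
    (hR2 : ∀ v ∈ Dset n k, ∃! u, u ∈ R ∧ Relation.EqvGen (genRel n k) u v) :
    Set.finrank F (Zset n F k A) =
      Set.finrank F (Bset n F k) + ∑ u ∈ R.attach, Set.finrank F (Lsub n F ω k A u.1) := by
  let Θ := theta hchar hω A R
  have hker : (fun φ : cocycles n F k A => (φ : (Fin k → ZMod n) → F)) '' (LinearMap.ker Θ) =
      Bset n F k := by
    ext φ
    constructor
    · rintro ⟨φ, hφ, rfl⟩
      refine (forall_Eset_eq_zero_iff hk hchar hω hR1 hR2 φ.2.1).1 fun u hu v hv => ?_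
      exact congrFun (congrArg Subtype.val (congrFun (LinearMap.mem_ker.1 hφ) ⟨u, hu⟩)) ⟨v, hv⟩
    · intro hφ
      have hZ := Bset_subset_Zset hk hchar hω A hφ
      refine ⟨⟨φ, hZ⟩, LinearMap.mem_ker.2 ?_, rfl⟩
      funext u
      refine Subtype.ext (funext fun v => ?_)
      exact (forall_Eset_eq_zero_iff hk hchar hω hR1 hR2 hZ.1).2 hφ u.1 u.2 v.1 v.2
  have hB : Set.finrank F (Bset n F k) = Module.finrank F (LinearMap.ker Θ) := by
    have h1 : Bset n F k = ((LinearMap.ker Θ).map (cocycles n F k A).subtype : Set _) := by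
      rw [← hker]; rfl
    rw [h1, set_finrank_coe, Submodule.finrank_map_subtype_eq]
  have hrange : LinearMap.range Θ = ⊤ := by
    refine LinearMap.range_eq_top.2 fun g => ?_
    obtain ⟨φ, hφ, h⟩ := exists_mem_Zset_restrict_eq hcop hchar hω A hR1 hR2
      (fun u => (g u).1) fun u => (g u).2
    exact ⟨⟨φ, hφ⟩, funext fun u => Subtype.ext (funext fun v => h u v)⟩
  have h1 := LinearMap.finrank_range_add_finrank_ker Θ
  rw [hrange, finrank_top, Module.finrank_pi_fintype, Finset.univ_eq_attach] at h1
  rw [hB, show Set.finrank F (Zset n F k A) = _ from set_finrank_coe (cocycles n F k A), ← h1,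
    add_comm]
  congr 1
  exact Finset.sum_congr rfl fun u _ => (set_finrank_coe (Lsubmodule n F ω k A u.1)).symm

end Dimension

end SumComplex

/-- for `R` a set of representatives of the orbits of `G_{n,k}` on
`D_{n,k}`, the map `Θ : φ ↦ (φ̂|_{E_u})_{u ∈ R}` maps `Z^{k-1}(X_A;F)` onto
`⊕_{u∈R} L_u` with kernel `B^{k-1}(X_A;F)`; in particular
`dim Z^{k-1} = dim B^{k-1} + ∑_{u∈R} dim L_u`. -/
theorem theta_surjective_kernel (n k : ℕ) [NeZero n] (hk : 0 < k)
    (hcop : Nat.Coprime (k + 1) n) (A : Finset (ZMod n)) (hA : A.card = k + 1)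
    (F : Type*) [Field F] (hchar : ¬ (ringChar F ∣ n)) (ω : F)
    (hω : IsPrimitiveRoot ω n) (R : Finset (Fin k → ZMod n))
    (hR1 : ↑R ⊆ Dset n k)
    (hR2 : ∀ v ∈ Dset n k, ∃! u, u ∈ R ∧ Relation.EqvGen (genRel n k) u v) :
    (∀ g : (u : {u // u ∈ R}) → (↥(Eset n k u.1) → F),
      (∀ u : {u // u ∈ R}, g u ∈ Lsub n F ω k A u.1) →
      ∃ φ ∈ Zset n F k A, ∀ (u : {u // u ∈ R}) (v : ↥(Eset n k u.1)),
        fourierT n F ω k φ v.1 = g u v) ∧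
    (∀ φ ∈ Zset n F k A,
      ((∀ u ∈ R, ∀ v ∈ Eset n k u, fourierT n F ω k φ v = 0) ↔ φ ∈ Bset n F k)) ∧
    Set.finrank F (Zset n F k A) =
      Set.finrank F (Bset n F k) +
        ∑ u ∈ R.attach, Set.finrank F (Lsub n F ω k A u.1) := by
  exact ⟨fun g hg => SumComplex.exists_mem_Zset_restrict_eq hcop hchar hω A hR1 hR2 g hg,
    fun φ hφ => SumComplex.forall_Eset_eq_zero_iff hk hchar hω hR1 hR2 hφ.1,
    SumComplex.finrank_Zset hk hcop hchar hω A hR1 hR2⟩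
end

section
/- Let n be a prime, let k be a positive integer with k+1 < n, and let A ⊆ ℤ_n with |A| = k+1. For a ∈ A set l_a = (k+1)^{-1}·(a − ∑_{b∈A} b) ∈ ℤ_n. Then a k-element subset y of ℤ_n is contained in exactly one facet of X_A if and only if y = {a' + l_a : a' ∈ A, a' ≠ a} for some a ∈ A; moreover these k+1 subsets are pairwise distinct, so X_A has exactly k+1 free (k−1)-faces. -/
open scoped BigOperators

/-- The facets of the sum complex `X_A`: the `(k+1)`-element subsets `σ ⊆ ℤ_n`
with `∑_{x ∈ σ} x ∈ A`. -/
def sumComplexFacets (n k : ℕ) [NeZero n] (A : Finset (ZMod n)) :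
    Finset (Finset (ZMod n)) :=
  Finset.univ.filter (fun σ => σ.card = k + 1 ∧ (∑ x ∈ σ, x) ∈ A)

/-- The facets of `X_A` containing a `k`-element set `y` are obtained by adding to `y` a vertex
of the translate `A - ∑ x ∈ y, x` outside `y`. -/
theorem card_filter_subset_sumComplexFacets {n k : ℕ} [NeZero n] (A : Finset (ZMod n))
    {y : Finset (ZMod n)} (hy : y.card = k) :
    ((sumComplexFacets n k A).filter (fun σ => y ⊆ σ)).card =
      (A.image (fun a => a + -∑ x ∈ y, x) \ y).card := by
  have himage : (sumComplexFacets n k A).filter (fun σ => y ⊆ σ) =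
      (A.image (fun a => a + -∑ x ∈ y, x) \ y).image (fun v => insert v y) := by
    ext σ
    simp only [sumComplexFacets, Finset.mem_filter, Finset.mem_univ, true_and,
      Finset.mem_image, Finset.mem_sdiff]
    constructor
    · rintro ⟨⟨hcard, hsum⟩, hsub⟩
      obtain ⟨v, hv, rfl⟩ : ∃ v ∉ y, insert v y = σ :=
        Finset.covBy_iff_exists_insert.1
          (Finset.covBy_iff_card_sdiff_eq_one.2
            ⟨hsub, by rw [Finset.card_sdiff_of_subset hsub]; omega⟩)
      rw [Finset.sum_insert hv] at hsum
      exact ⟨v, ⟨⟨_, hsum, by ring⟩, hv⟩, rfl⟩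
    · rintro ⟨v, ⟨⟨a, ha, rfl⟩, hv⟩, rfl⟩
      refine ⟨⟨by rw [Finset.card_insert_of_notMem hv, hy], ?_⟩, Finset.subset_insert _ _⟩
      rw [Finset.sum_insert hv]
      simpa using ha
  rw [himage, Finset.card_image_of_injOn]
  intro v hv w hw h
  have hv' : v ∉ y := (Finset.mem_sdiff.1 hv).2
  have hmem : v ∈ insert w y := by
    have h' : insert v y = insert w y := h
    rw [← h']
    exact Finset.mem_insert_self v y
  exact (Finset.mem_insert.1 hmem).resolve_right hv'

/-- A `k`-element set `y` is free in `X_A` exactly when it is a translate of `A` by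
`-∑ x ∈ y, x` with one point removed. -/
theorem card_filter_subset_sumComplexFacets_eq_one_iff {n k : ℕ} [NeZero n]
    {A : Finset (ZMod n)} (hA : A.card = k + 1) {y : Finset (ZMod n)} (hy : y.card = k) :
    ((sumComplexFacets n k A).filter (fun σ => y ⊆ σ)).card = 1 ↔
      ∃ a ∈ A, y = (A.erase a).image (fun a' => a' + -∑ x ∈ y, x) := by
  have hinj : Function.Injective (fun a' : ZMod n => a' + -∑ x ∈ y, x) := add_left_injective _
  have hcard : (A.image (fun a' => a' + -∑ x ∈ y, x)).card = k + 1 := by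
    rw [Finset.card_image_of_injective _ hinj, hA]
  rw [card_filter_subset_sumComplexFacets A hy]
  constructor
  · intro h
    have hsub : y ⊆ A.image (fun a' => a' + -∑ x ∈ y, x) := by
      have h₁ := Finset.card_sdiff_add_card_inter (A.image (fun a' => a' + -∑ x ∈ y, x)) y
      have h₂ := Finset.eq_of_subset_of_card_le
        (Finset.inter_subset_right (s₁ := A.image (fun a' => a' + -∑ x ∈ y, x)) (s₂ := y))
        (by omega)
      exact Finset.inter_eq_right.1 h₂
    obtain ⟨v, hv⟩ := Finset.card_eq_one.1 h
    have hvA : v ∈ A.image (fun a' => a' + -∑ x ∈ y, x) :=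
      (Finset.mem_sdiff.1 (hv ▸ Finset.mem_singleton_self v)).1
    obtain ⟨a, ha, hav⟩ := Finset.mem_image.1 hvA
    refine ⟨a, ha, ?_⟩
    rw [Finset.image_erase hinj, Finset.erase_eq, hav, ← hv, Finset.sdiff_sdiff_eq_self hsub]
  · rintro ⟨a, ha, h⟩
    have hsub : y ⊆ A.image (fun a' => a' + -∑ x ∈ y, x) := by
      conv_lhs => rw [h]
      exact Finset.image_subset_image (Finset.erase_subset _ _)
    rw [Finset.card_sdiff_of_subset hsub]
    omega

/-- The sum of a translate of `A` with one point removed. -/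
theorem sum_image_erase_add {R : Type*} [CommRing R] [DecidableEq R] {k : ℕ} {A : Finset R}
    (hA : A.card = k + 1) {a : R} (ha : a ∈ A) (t : R) :
    ∑ x ∈ (A.erase a).image (fun a' => a' + t), x = ∑ b ∈ A, b - a + k * t := by
  rw [Finset.sum_image (fun _ _ _ _ h => add_left_injective t h), Finset.sum_add_distrib,
    Finset.sum_const, Finset.card_erase_of_mem ha, hA, ← Finset.sum_erase_add A _ ha]
  simp

/-- for `n` prime, `k+1 < n`, `|A| = k+1`, setting
`l_a = (k+1)⁻¹(a - ∑_{b∈A} b)`, a `k`-element subset `y ⊆ ℤ_n` is contained in exactly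
one facet of `X_A` iff `y = {a' + l_a : a' ∈ A, a' ≠ a}` for some `a ∈ A`; these `k+1`
subsets are pairwise distinct, so `X_A` has exactly `k+1` free `(k-1)`-faces. -/
theorem free_faces_of_sum_complex (n k : ℕ) [NeZero n] (hn : n.Prime) (hk : 0 < k)
    (hkn : k + 1 < n) (A : Finset (ZMod n)) (hA : A.card = k + 1) :
    (∀ y : Finset (ZMod n), y.card = k →
      (((sumComplexFacets n k A).filter (fun σ => y ⊆ σ)).card = 1 ↔
        ∃ a ∈ A, y = (A.erase a).image
          (fun a' => a' + ((k + 1 : ZMod n))⁻¹ * (a - ∑ b ∈ A, b)))) ∧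
    (∀ a ∈ A, ∀ b ∈ A,
      (A.erase a).image (fun a' => a' + ((k + 1 : ZMod n))⁻¹ * (a - ∑ c ∈ A, c)) =
        (A.erase b).image (fun a' => a' + ((k + 1 : ZMod n))⁻¹ * (b - ∑ c ∈ A, c)) →
      a = b) ∧
    (Finset.univ.filter (fun y : Finset (ZMod n) => y.card = k ∧
        ((sumComplexFacets n k A).filter (fun σ => y ⊆ σ)).card = 1)).card = k + 1 := by
  have : Fact n.Prime := ⟨hn⟩
  have hk0 : (k + 1 : ZMod n) ≠ 0 := by
    intro h
    have h' : ((k + 1 : ℕ) : ZMod n) = 0 := by exact_mod_cast h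
    rw [ZMod.natCast_eq_zero_iff] at h'
    exact absurd (Nat.le_of_dvd k.succ_pos h') (by omega)
  have hmul : ∀ a : ZMod n,
      (k + 1 : ZMod n) * ((k + 1 : ZMod n)⁻¹ * (a - ∑ b ∈ A, b)) = a - ∑ b ∈ A, b :=
    fun a => mul_inv_cancel_left₀ hk0 _
  have hsum : ∀ a ∈ A, ∑ x ∈ (A.erase a).image
      (fun a' => a' + ((k + 1 : ZMod n))⁻¹ * (a - ∑ b ∈ A, b)), x =
        -((k + 1 : ZMod n)⁻¹ * (a - ∑ b ∈ A, b)) := by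
    intro a ha
    rw [sum_image_erase_add hA ha]
    linear_combination hmul a
  have hfree : ∀ y : Finset (ZMod n), y.card = k →
      (((sumComplexFacets n k A).filter (fun σ => y ⊆ σ)).card = 1 ↔
        ∃ a ∈ A, y = (A.erase a).image
          (fun a' => a' + ((k + 1 : ZMod n))⁻¹ * (a - ∑ b ∈ A, b))) := by
    intro y hy
    rw [card_filter_subset_sumComplexFacets_eq_one_iff hA hy]
    refine exists_congr fun a => and_congr_right fun ha => ?_
    constructor
    · intro h
      have hs := sum_image_erase_add hA ha (-∑ x ∈ y, x)
      rw [← h] at hs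
      have ht : -∑ x ∈ y, x = (k + 1 : ZMod n)⁻¹ * (a - ∑ b ∈ A, b) := by
        apply mul_left_cancel₀ hk0
        rw [hmul]
        linear_combination -hs
      rwa [ht] at h
    · intro h
      have hs := hsum a ha
      rw [← h] at hs
      rwa [hs, neg_neg]
  have hinj : ∀ a ∈ A, ∀ b ∈ A,
      (A.erase a).image (fun a' => a' + ((k + 1 : ZMod n))⁻¹ * (a - ∑ c ∈ A, c)) =
        (A.erase b).image (fun a' => a' + ((k + 1 : ZMod n))⁻¹ * (b - ∑ c ∈ A, c)) →
      a = b := by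
    intro a ha b hb h
    have hs := hsum a ha
    rw [h, hsum b hb] at hs
    exact (sub_left_injective (mul_left_cancel₀ (inv_ne_zero hk0) (neg_injective hs))).symm
  refine ⟨hfree, hinj, ?_⟩
  rw [← hA, ← Finset.card_image_of_injOn (s := A) (fun a ha b hb h => hinj a ha b hb h)]
  congr 1
  ext y
  simp only [Finset.mem_filter, Finset.mem_univ, true_and, Finset.mem_image]
  constructor
  · rintro ⟨hy, h⟩
    obtain ⟨a, ha, rfl⟩ := (hfree y hy).1 h
    exact ⟨a, ha, rfl⟩
  · rintro ⟨a, ha, rfl⟩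
    have hcard : ((A.erase a).image
        (fun a' => a' + ((k + 1 : ZMod n))⁻¹ * (a - ∑ c ∈ A, c))).card = k := by
      rw [Finset.card_image_of_injective _ (add_left_injective _), Finset.card_erase_of_mem ha, hA,
        Nat.add_sub_cancel]
    exact ⟨hcard, (hfree _ hcard).2 ⟨a, ha, rfl⟩⟩
end

section
/- Let F be a field of characteristic p (p prime or zero), let n be coprime to 3 and not divisible by p, and let ω ∈ F be a primitive n-th root of unity. Let A = {0,1,3} ⊆ ℤ_n and let B = {0, b, c} ⊆ ℤ_n with b, c nonzero and distinct. Setting u = ω^{-b} and v = ω^{-c} (exponents via representatives), the determinant of the 3×3 Fourier submatrix M_{A,B} equals (u−1)(v−1)(v−u)(u+v+1). In particular M_{A,B} has rank 2 if 1 + u + v = 0 and rank 3 otherwise. -/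
open scoped BigOperators

theorem Matrix.rank_lt_card_of_det_eq_zero {m K : Type*} [Field K] [Fintype m] [DecidableEq m]
    {A : Matrix m m K} (h : A.det = 0) : A.rank < Fintype.card m := by
  refine lt_of_le_of_ne A.rank_le_card_width fun hr => ?_
  have hli : LinearIndependent K A.row := by
    rw [linearIndependent_iff_card_eq_finrank_span, ← hr, Matrix.rank_eq_finrank_span_row]
    rfl
  rw [Matrix.linearIndependent_rows_iff_isUnit, Matrix.isUnit_iff_isUnit_det, h] at hli
  exact not_isUnit_zero hli

section FourierCharacter

variable {n : ℕ} [NeZero n] {F : Type*} [Field F] {ω : F}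

theorem eF_zero : eF n F ω 0 = 1 := by
  simp [eF]

theorem eF_natCast_mul (hω : ω ^ n = 1) (k : ℕ) (x : ZMod n) :
    eF n F ω (k * x) = eF n F ω x ^ k := by
  have hval : ((k : ZMod n) * x).val = (x.val * k) % n := by
    rw [← ZMod.val_natCast]
    simp [mul_comm]
  rw [eF, eF, hval, ← pow_mul, ← pow_eq_pow_mod _ hω]

theorem eF_injective (hω : IsPrimitiveRoot ω n) : Function.Injective (eF n F ω) :=
  fun x y h => ZMod.val_injective n (hω.pow_inj x.val_lt y.val_lt h)

theorem fourierSubmatrix_013_eq (hω : ω ^ n = 1) (b c : ZMod n) :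
    (Matrix.of fun i j : Fin 3 => eF n F ω (-(![0, 1, 3] i * ![(0 : ZMod n), b, c] j))) =
      !![1, 1, 1;
         1, eF n F ω (-b), eF n F ω (-c);
         1, eF n F ω (-b) ^ 3, eF n F ω (-c) ^ 3] := by
  have h3 (x : ZMod n) : eF n F ω (-(3 * x)) = eF n F ω (-x) ^ 3 := by
    rw [← eF_natCast_mul hω 3 (-x)]
    simp
  ext i j
  fin_cases i <;> fin_cases j <;> simp [eF_zero, h3]

end FourierCharacter

/-- for `A = {0,1,3}` and `B = {0,b,c}` (with `b, c` nonzero and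
distinct), setting `u = ω^{-b}` and `v = ω^{-c}`, the determinant of the Fourier
submatrix `M_{A,B} = (e(-aβ))_{a∈A, β∈B}` equals `(u-1)(v-1)(v-u)(u+v+1)`;
consequently `M_{A,B}` has rank `2` if `1+u+v = 0` and rank `3` otherwise. -/
theorem det_fourier_submatrix_013 (F : Type*) [Field F] (n : ℕ) [NeZero n]
    (hn3 : Nat.Coprime n 3) (hchar : ¬ (ringChar F ∣ n)) (ω : F)
    (hω : IsPrimitiveRoot ω n) (b c : ZMod n) (hb : b ≠ 0) (hc : c ≠ 0)
    (hbc : b ≠ c) :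
    Matrix.det (Matrix.of fun i j : Fin 3 =>
        eF n F ω (-(![0, 1, 3] i * ![(0 : ZMod n), b, c] j)))
      = (eF n F ω (-b) - 1) * (eF n F ω (-c) - 1) *
        (eF n F ω (-c) - eF n F ω (-b)) * (eF n F ω (-b) + eF n F ω (-c) + 1) ∧
    (1 + eF n F ω (-b) + eF n F ω (-c) = 0 →
      Matrix.rank (Matrix.of fun i j : Fin 3 =>
        eF n F ω (-(![0, 1, 3] i * ![(0 : ZMod n), b, c] j))) = 2) ∧
    (1 + eF n F ω (-b) + eF n F ω (-c) ≠ 0 →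
      Matrix.rank (Matrix.of fun i j : Fin 3 =>
        eF n F ω (-(![0, 1, 3] i * ![(0 : ZMod n), b, c] j))) = 3) := by
  have hu : eF n F ω (-b) ≠ 1 := by
    rw [← eF_zero (n := n) (ω := ω)]
    exact (eF_injective hω).ne (neg_ne_zero.mpr hb)
  have hv : eF n F ω (-c) ≠ 1 := by
    rw [← eF_zero (n := n) (ω := ω)]
    exact (eF_injective hω).ne (neg_ne_zero.mpr hc)
  have huv : eF n F ω (-c) ≠ eF n F ω (-b) :=
    (eF_injective hω).ne (neg_injective.ne hbc.symm)
  rw [fourierSubmatrix_013_eq hω.pow_eq_one]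
  generalize eF n F ω (-b) = u at *
  generalize eF n F ω (-c) = v at *
  have hdet : Matrix.det !![1, 1, 1; 1, u, v; 1, u ^ 3, v ^ 3] =
      (u - 1) * (v - 1) * (v - u) * (u + v + 1) := by
    rw [Matrix.det_fin_three]
    simp
    ring
  refine ⟨hdet, fun h => le_antisymm ?_ ?_, fun h => ?_⟩
  · refine Nat.le_of_lt_succ (Matrix.rank_lt_card_of_det_eq_zero ?_)
    rw [hdet, show u + v + 1 = 0 by rw [← h]; ring, mul_zero]
  · have hminor : (Matrix.submatrix !![1, 1, 1; 1, u, v; 1, u ^ 3, v ^ 3]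
        ![0, 1] ![0, 1]).rank = 2 := by
      rw [Matrix.rank_of_det_ne_zero, Fintype.card_fin]
      rw [Matrix.det_fin_two]
      simpa using sub_ne_zero.mpr hu
    exact hminor.symm.trans_le (Matrix.rank_submatrix_le _ _ _)
  · rw [Matrix.rank_of_det_ne_zero, Fintype.card_fin]
    rw [hdet]
    have hs : u + v + 1 ≠ 0 := by
      rwa [show u + v + 1 = 1 + u + v by ring]
    exact mul_ne_zero (mul_ne_zero (mul_ne_zero (sub_ne_zero.mpr hu) (sub_ne_zero.mpr hv))
      (sub_ne_zero.mpr huv)) hs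
end

section
/- Let p be a prime and let n be a positive integer coprime to 3p. Let k = 2 and A = {0,1,3} ⊆ ℤ_n. Then h_2(X_A;𝔽_p), the dimension over 𝔽_p of the space of 𝔽_p-linear combinations of facets of X_A with vanishing boundary, equals (1/3)·|{ {u,v} ⊆ U_{p,n} ∖ {1} : u ≠ v and 1 + u + v = 0 }|, where U_{p,n} is the group of n-th roots of unity in an algebraic closure of 𝔽_p. -/
open scoped BigOperators

/-- Coefficient of `τ` in the simplicial boundary of `σ`, ordering the elements of `σ`
by their representatives in `{0, …, n-1}`: it is `(-1)^i` if `τ = σ \ {x}` where `x`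
is the `i`-th smallest element of `σ`, and `0` otherwise. -/
noncomputable def bdryCoeff (n : ℕ) [NeZero n] (F : Type*) [Field F]
    (σ τ : Finset (ZMod n)) : F :=
  ∑ x ∈ σ, if τ = σ.erase x then
    (-1 : F) ^ ((σ.filter (fun y => y.val < x.val)).card) else 0

/-- The simplicial boundary operator `∂` on the chain space of `ℤ_n`
(the free `F`-vector space on the finite subsets of `ℤ_n`). -/
noncomputable def bdry (n : ℕ) [NeZero n] (F : Type*) [Field F] :
    (Finset (ZMod n) → F) →ₗ[F] (Finset (ZMod n) → F) where
  toFun c := fun τ => ∑ σ : Finset (ZMod n), c σ * bdryCoeff n F σ τ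
  map_add' c d := by
    funext τ
    simp [add_mul, Finset.sum_add_distrib]
  map_smul' r c := by
    funext τ
    simp [Finset.mul_sum, mul_assoc]

/-- The basis vector of the chain space corresponding to a finite subset `σ ⊆ ℤ_n`. -/
noncomputable def ind (n : ℕ) [NeZero n] (F : Type*) [Field F] (σ : Finset (ZMod n)) :
    Finset (ZMod n) → F :=
  fun τ => if τ = σ then 1 else 0

/-- `h_k(X_A; F)`: the dimension of the kernel of the restriction of the boundary
operator `∂` to the span of the facets of the sum complex `X_A`. -/
noncomputable def hTop (n : ℕ) [NeZero n] (F : Type*) [Field F] (k : ℕ)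
    (A : Finset (ZMod n)) : ℕ :=
  Module.finrank F (LinearMap.ker ((bdry n F).domRestrict
    (Submodule.span F (ind n F '' ↑(sumComplexFacets n k A)))))

theorem finrank_ker_toLin'_map_algebraMap {F K : Type*} [Field F] [Field K] [Algebra F K]
    {m ι : Type*} [Fintype m] [Fintype ι] [DecidableEq m] [DecidableEq ι] (M : Matrix m ι F) :
    Module.finrank K (LinearMap.ker (Matrix.toLin' (M.map (algebraMap F K)))) =
      Module.finrank F (LinearMap.ker (Matrix.toLin' M)) := by
  set f := Matrix.toLin' M
  set g := Matrix.toLin' (M.map (algebraMap F K))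
  let e := TensorProduct.piScalarRight F K K ι
  let e' := TensorProduct.piScalarRight F K K m
  let f' := TensorProduct.AlgebraTensorModule.lTensor K K f
  have hcomm : g ∘ₗ e.toLinearMap = e'.toLinearMap ∘ₗ f' := by
    ext i j
    simp [e, e', f', f, g, TensorProduct.piScalarRight_apply, Algebra.smul_def,
      Matrix.mulVec, dotProduct, Pi.single_apply, apply_ite]
  have hker : (LinearMap.ker g).comap e.toLinearMap = LinearMap.ker f' := by
    rw [← LinearMap.ker_comp, hcomm, LinearEquiv.ker_comp]
  have hmap : LinearMap.ker g = (LinearMap.ker f').map e.toLinearMap := by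
    rw [← hker, Submodule.map_comap_eq_of_surjective e.surjective]
  rw [hmap, LinearEquiv.finrank_map_eq,
    ← (LinearMap.tensorKerEquiv K K f).finrank_eq, Module.finrank_baseChange]

/-- Cycles supported on the facets of a sum complex are the kernel of this matrix, whose
first block is the boundary and whose second block is the restriction to non-facets. -/
noncomputable def cycleMatrix (n : ℕ) [NeZero n] (F : Type*) [Field F] (k : ℕ)
    (A : Finset (ZMod n)) : Matrix (Finset (ZMod n) ⊕ Finset (ZMod n)) (Finset (ZMod n)) F :=
  Matrix.of fun r σ => Sum.elim (fun τ => bdryCoeff n F σ τ)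
    (fun τ => if τ = σ ∧ τ ∉ sumComplexFacets n k A then 1 else 0) r

theorem mem_span_ind (n : ℕ) [NeZero n] (F : Type*) [Field F] (S : Finset (Finset (ZMod n)))
    (c : Finset (ZMod n) → F) :
    c ∈ Submodule.span F (ind n F '' ↑S) ↔ ∀ σ ∉ S, c σ = 0 := by
  constructor
  · intro hc σ hσ
    induction hc using Submodule.span_induction with
    | mem x hx =>
      obtain ⟨τ, hτ, rfl⟩ := hx
      have : σ ≠ τ := fun h => hσ (h ▸ hτ)
      simp [ind, this]
    | zero => rfl
    | add x y _ _ hx hy => simp [hx, hy]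
    | smul a x _ hx => simp [hx]
  · intro hc
    have : c = ∑ σ ∈ S, c σ • ind n F σ := by
      funext τ
      by_cases hτ : τ ∈ S
      · simp [ind, hτ]
      · simp [ind, hτ, hc τ hτ]
    rw [this]
    exact Submodule.sum_mem _ fun σ hσ =>
      Submodule.smul_mem _ _ (Submodule.subset_span ⟨σ, hσ, rfl⟩)

theorem mem_ker_cycleMatrix (n : ℕ) [NeZero n] (F : Type*) [Field F] (k : ℕ)
    (A : Finset (ZMod n)) (c : Finset (ZMod n) → F) :
    c ∈ LinearMap.ker (Matrix.toLin' (cycleMatrix n F k A)) ↔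
      (∀ σ ∉ sumComplexFacets n k A, c σ = 0) ∧ bdry n F c = 0 := by
  rw [LinearMap.mem_ker, funext_iff, Sum.forall, and_comm]
  refine and_congr (forall_congr' fun σ => ?_) ?_
  · by_cases h : σ ∈ sumComplexFacets n k A <;>
      simp [cycleMatrix, Matrix.mulVec, dotProduct, h]
  · rw [funext_iff]
    refine forall_congr' fun τ => ?_
    simp [cycleMatrix, Matrix.mulVec, dotProduct, bdry, mul_comm]

theorem hTop_eq_finrank_ker_cycleMatrix (n : ℕ) [NeZero n] (F : Type*) [Field F] (k : ℕ)
    (A : Finset (ZMod n)) :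
    hTop n F k A = Module.finrank F (LinearMap.ker (Matrix.toLin' (cycleMatrix n F k A))) := by
  have h : LinearMap.ker (Matrix.toLin' (cycleMatrix n F k A)) =
      (LinearMap.ker ((bdry n F).domRestrict
        (Submodule.span F (ind n F '' ↑(sumComplexFacets n k A))))).map
        (Submodule.subtype _) := by
    ext c
    rw [mem_ker_cycleMatrix, ← mem_span_ind]
    simp [and_comm]
  rw [h, Submodule.finrank_map_subtype_eq, hTop]

theorem hTop_eq_of_algebra (n : ℕ) [NeZero n] (F K : Type*) [Field F] [Field K] [Algebra F K]
    (k : ℕ) (A : Finset (ZMod n)) : hTop n F k A = hTop n K k A := by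
  have h : (cycleMatrix n F k A).map (algebraMap F K) = cycleMatrix n K k A := by
    ext r σ
    rcases r with τ | τ
    · simp [cycleMatrix, bdryCoeff, apply_ite]
    · simp [cycleMatrix, apply_ite]
  rw [hTop_eq_finrank_ker_cycleMatrix, hTop_eq_finrank_ker_cycleMatrix,
    ← finrank_ker_toLin'_map_algebraMap (K := K), h]

/-- Alternating functions of three variables, in any characteristic. -/
structure IsAlternating₃ {Z R : Type*} [Ring R] (f : Z → Z → Z → R) : Prop where
  swap_left : ∀ x y z, f y x z = -f x y z
  swap_right : ∀ x y z, f x z y = -f x y z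
  diag : ∀ x z, f x x z = 0

namespace IsAlternating₃

variable {Z R : Type*} [CommRing R] {f g : Z → Z → Z → R}

theorem diag_right (hf : IsAlternating₃ f) (x z : Z) : f z x x = 0 := by
  have h := hf.swap_left x z x
  rw [hf.swap_right x x z, hf.diag] at h
  simpa using h

theorem diag_outer (hf : IsAlternating₃ f) (x z : Z) : f x z x = 0 := by
  rw [hf.swap_left z x x, hf.diag_right, neg_zero]

/-- Two alternating functions change by the same sign under a permutation. -/
theorem mul_eq_mul (hf : IsAlternating₃ f) (hg : IsAlternating₃ g) {i j k i' j' k' : Z}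
    (hi : i' = i ∨ i' = j ∨ i' = k) (hj : j' = i ∨ j' = j ∨ j' = k)
    (hk : k' = i ∨ k' = j ∨ k' = k) :
    f i j k * g i' j' k' = f i' j' k' * g i j k := by
  have perm : ∀ {h : Z → Z → Z → R}, IsAlternating₃ h →
      h i k j = -h i j k ∧ h j i k = -h i j k ∧ h k j i = -h i j k ∧
      h j k i = h i j k ∧ h k i j = h i j k := by
    intro h hh
    refine ⟨hh.swap_right _ _ _, hh.swap_left _ _ _, ?_, ?_, ?_⟩
    · rw [hh.swap_right k i j, hh.swap_left i k j, hh.swap_right i j k, neg_neg]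
    · rw [hh.swap_right j i k, hh.swap_left i j k, neg_neg]
    · rw [hh.swap_left i k j, hh.swap_right i j k, neg_neg]
  obtain ⟨f1, f2, f3, f4, f5⟩ := perm hf
  obtain ⟨g1, g2, g3, g4, g5⟩ := perm hg
  rcases hi with rfl | rfl | rfl <;> rcases hj with rfl | rfl | rfl <;>
    rcases hk with rfl | rfl | rfl <;>
    simp only [hf.diag, hg.diag, hf.diag_right, hg.diag_right, hf.diag_outer, hg.diag_outer,
      f1, f2, f3, f4, f5, g1, g2, g3, g4, g5] <;> ring

end IsAlternating₃

section Orientation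

variable {n : ℕ} {F : Type*} [Field F]

/-- The sign comparing the representatives of two residues. -/
def orderSign (F : Type*) [Field F] (x y : ZMod n) : F :=
  if x.val < y.val then 1 else if y.val < x.val then -1 else 0

/-- The sign of an ordered triple of residues relative to the order of representatives. -/
def tripleSign (F : Type*) [Field F] (x y z : ZMod n) : F :=
  orderSign F x y * orderSign F y z * orderSign F x z

theorem orderSign_swap (x y : ZMod n) : orderSign F y x = -orderSign F x y := by
  unfold orderSign
  split_ifs <;> first | omega | simp

theorem orderSign_self (x : ZMod n) : orderSign F x x = 0 := by
  simp [orderSign]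

theorem isAlternating₃_tripleSign : IsAlternating₃ (tripleSign F (n := n)) where
  swap_left x y z := by
    simp only [tripleSign]
    rw [orderSign_swap x y]
    ring
  swap_right x y z := by
    simp only [tripleSign]
    rw [orderSign_swap y z]
    ring
  diag x z := by simp [tripleSign, orderSign_self]

/-- The alternating function attached to a chain. -/
def alternatize (c : Finset (ZMod n) → F) (x y z : ZMod n) : F :=
  tripleSign F x y z * c {x, y, z}

theorem isAlternating₃_alternatize (c : Finset (ZMod n) → F) :
    IsAlternating₃ (alternatize c) where
  swap_left x y z := by
    simp only [alternatize]
    rw [isAlternating₃_tripleSign.swap_left, Finset.insert_comm, neg_mul]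
  swap_right x y z := by
    simp only [alternatize]
    rw [isAlternating₃_tripleSign.swap_right, Finset.pair_comm, neg_mul]
  diag x z := by simp [alternatize, isAlternating₃_tripleSign.diag]

variable [NeZero n]

theorem orderSign_mul_self {x y : ZMod n} (h : x ≠ y) :
    orderSign F x y * orderSign F x y = 1 := by
  have : x.val ≠ y.val := fun h' => h (ZMod.val_injective n h')
  unfold orderSign
  split_ifs <;> first | omega | simp

theorem tripleSign_mul_self {x y z : ZMod n} (hxy : x ≠ y) (hxz : x ≠ z) (hyz : y ≠ z) :
    tripleSign F x y z * tripleSign F x y z = 1 := by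
  calc _ = (orderSign F x y * orderSign F x y) * (orderSign F y z * orderSign F y z) *
        (orderSign F x z * orderSign F x z) := by unfold tripleSign; ring
    _ = 1 := by simp [orderSign_mul_self, hxy, hxz, hyz]

/-- Every alternating function comes from a chain supported on triples. -/
theorem exists_alternatize_eq {f : ZMod n → ZMod n → ZMod n → F} (hf : IsAlternating₃ f) :
    ∃ c : Finset (ZMod n) → F, (∀ σ, σ.card ≠ 3 → c σ = 0) ∧ alternatize c = f := by
  have key : ∀ σ : Finset (ZMod n), ∃ a : F, (σ.card ≠ 3 → a = 0) ∧
      ∀ x y z, x ≠ y → x ≠ z → y ≠ z → σ = {x, y, z} → tripleSign F x y z * a = f x y z := by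
    intro σ
    by_cases h : σ.card = 3
    · obtain ⟨x, y, z, hxy, hxz, hyz, rfl⟩ := Finset.card_eq_three.mp h
      refine ⟨tripleSign F x y z * f x y z, fun h' => absurd h h', ?_⟩
      intro x' y' z' _ _ _ hσ
      have hmem : ∀ t ∈ ({x', y', z'} : Finset (ZMod n)), t = x ∨ t = y ∨ t = z := by
        intro t ht
        rw [← hσ] at ht
        simpa using ht
      have h1 := hf.mul_eq_mul (isAlternating₃_tripleSign (F := F)) (hmem x' (by simp))
        (hmem y' (by simp)) (hmem z' (by simp))
      calc _ = tripleSign F x y z * (f x y z * tripleSign F x' y' z') := by ring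
        _ = f x' y' z' * (tripleSign F x y z * tripleSign F x y z) := by rw [h1]; ring
        _ = _ := by rw [tripleSign_mul_self hxy hxz hyz, mul_one]
    · refine ⟨0, fun _ => rfl, ?_⟩
      intro x y z hxy hxz hyz hσ
      exact absurd (Finset.card_eq_three.mpr ⟨x, y, z, hxy, hxz, hyz, hσ⟩) h
  choose c hc0 hc using key
  refine ⟨c, hc0, ?_⟩
  funext x y z
  by_cases hxy : x = y
  · subst hxy
    rw [(isAlternating₃_alternatize c).diag, hf.diag]
  by_cases hxz : x = z
  · subst hxz
    rw [(isAlternating₃_alternatize c).diag_outer, hf.diag_outer]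
  by_cases hyz : y = z
  · subst hyz
    rw [(isAlternating₃_alternatize c).diag_right, hf.diag_right]
  exact hc _ x y z hxy hxz hyz rfl

theorem bdry_apply (c : Finset (ZMod n) → F) (τ : Finset (ZMod n)) :
    bdry n F c τ = ∑ x, if x ∈ τ then 0 else
      c (insert x τ) * (-1) ^ ((insert x τ).filter (fun y => y.val < x.val)).card := by
  have h : ∀ σ x : _, (x ∈ σ ∧ τ = σ.erase x) ↔ (x ∉ τ ∧ σ = insert x τ) := by
    intro σ x
    constructor
    · rintro ⟨hx, rfl⟩
      exact ⟨by simp, (Finset.insert_erase hx).symm⟩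
    · rintro ⟨hx, rfl⟩
      exact ⟨by simp, (Finset.erase_insert hx).symm⟩
  have h2 : ∀ σ, bdryCoeff n F σ τ = ∑ x, if x ∉ τ ∧ σ = insert x τ then
      (-1 : F) ^ ((σ.filter (fun y => y.val < x.val)).card) else 0 := by
    intro σ
    simp only [← h, bdryCoeff, ite_and]
    simp
  simp only [bdry, LinearMap.coe_mk, AddHom.coe_mk, h2, Finset.mul_sum]
  rw [Finset.sum_comm]
  refine Finset.sum_congr rfl fun x _ => ?_
  by_cases hx : x ∈ τ <;> simp [hx]

theorem neg_one_pow_card_filter_pair {x y z : ZMod n} (hxy : x ≠ y) (hxz : x ≠ z)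
    (hyz : y ≠ z) :
    (-1 : F) ^ (({x, y, z} : Finset (ZMod n)).filter (fun w => w.val < x.val)).card =
      orderSign F x y * orderSign F x z := by
  have h1 : x.val ≠ y.val := fun h' => hxy (ZMod.val_injective n h')
  have h2 : x.val ≠ z.val := fun h' => hxz (ZMod.val_injective n h')
  rw [Finset.filter_insert, Finset.filter_insert, Finset.filter_singleton]
  unfold orderSign
  split_ifs <;> first | omega | simp [hyz]

theorem sum_alternatize (c : Finset (ZMod n) → F) (y z : ZMod n) :
    ∑ x, alternatize c x y z = orderSign F y z * bdry n F c {y, z} := by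
  by_cases hyz : y = z
  · subst hyz
    simp [(isAlternating₃_alternatize c).diag_right, orderSign_self]
  rw [bdry_apply, Finset.mul_sum]
  refine Finset.sum_congr rfl fun x _ => ?_
  by_cases hx : x ∈ ({y, z} : Finset (ZMod n))
  · rw [if_pos hx, mul_zero]
    rcases (by simpa using hx : x = y ∨ x = z) with rfl | rfl
    · exact (isAlternating₃_alternatize c).diag _ _
    · exact (isAlternating₃_alternatize c).diag_outer _ _
  · rw [if_neg hx]
    simp only [Finset.mem_insert, Finset.mem_singleton, not_or] at hx
    rw [neg_one_pow_card_filter_pair hx.1 hx.2 hyz, alternatize, tripleSign]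
    ring

theorem bdry_eq_zero_iff (c : Finset (ZMod n) → F) (hc : ∀ σ, σ.card ≠ 3 → c σ = 0) :
    bdry n F c = 0 ↔ ∀ y z, ∑ x, alternatize c x y z = 0 := by
  constructor
  · intro h y z
    rw [sum_alternatize, h]
    simp
  · intro h
    funext τ
    by_cases hτ : τ.card = 2
    · obtain ⟨y, z, hyz, rfl⟩ := Finset.card_eq_two.mp hτ
      have h1 := h y z
      rw [sum_alternatize] at h1
      refine (mul_eq_zero.mp h1).resolve_left fun h0 => ?_
      simpa [h0] using orderSign_mul_self (F := F) hyz
    · rw [bdry_apply]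
      refine Finset.sum_eq_zero fun x _ => ?_
      split_ifs with hx
      · rfl
      · rw [hc, zero_mul]
        rw [Finset.card_insert_of_notMem hx]
        omega

theorem alternatize_eq_zero_iff (c : Finset (ZMod n) → F) {x y z : ZMod n} (hxy : x ≠ y)
    (hxz : x ≠ z) (hyz : y ≠ z) : alternatize c x y z = 0 ↔ c {x, y, z} = 0 := by
  refine ⟨fun h => (mul_eq_zero.mp h).resolve_left fun h0 => ?_, fun h => by simp [alternatize, h]⟩
  simpa [h0] using tripleSign_mul_self (F := F) hxy hxz hyz

end Orientation

section Fourier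

variable {n : ℕ} {K : Type*} [Field K]

/-- The `3 × 3` minor of the character table with rows `i`, `j`, `k`. -/
def charMinor (ψ : AddChar (ZMod n) K) (i j k x y z : ZMod n) : K :=
  ψ (i * x) * (ψ (j * y) * ψ (k * z) - ψ (k * y) * ψ (j * z)) -
  ψ (j * x) * (ψ (i * y) * ψ (k * z) - ψ (k * y) * ψ (i * z)) +
  ψ (k * x) * (ψ (i * y) * ψ (j * z) - ψ (j * y) * ψ (i * z))

/-- The values at `0`, `1`, `3` are the coefficients of the cubic with roots `ψ i`, `ψ j`,
`ψ k`, provided these have sum zero and product one. -/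
def cubicWeight (ψ : AddChar (ZMod n) K) (i j k : ZMod n) : ZMod n → K :=
  Pi.single 0 (-1) + Pi.single 1 (ψ i * ψ j + ψ j * ψ k + ψ k * ψ i) + Pi.single 3 1

theorem addChar_three_mul (ψ : AddChar (ZMod n) K) (i : ZMod n) : ψ (i * 3) = ψ i ^ 3 := by
  rw [show i * 3 = i + i + i by ring, AddChar.map_add_eq_mul, AddChar.map_add_eq_mul]
  ring

theorem cubicWeight_rotate (ψ : AddChar (ZMod n) K) (i j k : ZMod n) :
    cubicWeight ψ j k i = cubicWeight ψ i j k := by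
  unfold cubicWeight
  rw [show ψ j * ψ k + ψ k * ψ i + ψ i * ψ j = ψ i * ψ j + ψ j * ψ k + ψ k * ψ i by ring]

theorem cubicWeight_eq_zero (ψ : AddChar (ZMod n) K) (i j k : ZMod n) {s : ZMod n}
    (hs : s ∉ ({0, 1, 3} : Finset (ZMod n))) : cubicWeight ψ i j k s = 0 := by
  simp only [Finset.mem_insert, Finset.mem_singleton, not_or] at hs
  simp [cubicWeight, hs]

/-- The alternating cycle attached to the triple `i`, `j`, `k`. -/
def fourierCycle (ψ : AddChar (ZMod n) K) (i j k x y z : ZMod n) : K :=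
  cubicWeight ψ i j k (x + y + z) * charMinor ψ i j k x y z

theorem isAlternating₃_fourierCycle (ψ : AddChar (ZMod n) K) (i j k : ZMod n) :
    IsAlternating₃ (fourierCycle ψ i j k) where
  swap_left x y z := by
    rw [fourierCycle, fourierCycle, add_comm y x, charMinor, charMinor]
    ring
  swap_right x y z := by
    rw [fourierCycle, fourierCycle, add_right_comm x z y, charMinor, charMinor]
    ring
  diag x z := by
    rw [fourierCycle, charMinor]
    ring

variable [NeZero n]

/-- The Fourier transform of a function of three variables restricted to the triples with
sum `a`. -/
def sliceTransform (ψ : AddChar (ZMod n) K) (a : ZMod n) (f : ZMod n → ZMod n → ZMod n → K)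
    (i j k : ZMod n) : K :=
  ∑ x, ∑ y, ∑ z, if x + y + z = a then f x y z * ψ (-(i * x + j * y + k * z)) else 0

theorem sum_sum_eq_zero_of_antisymm {Z : Type*} [Fintype Z] [DecidableEq Z] (f : Z → Z → K)
    (hf : ∀ x y, f y x = -f x y) (hd : ∀ x, f x x = 0) : ∑ x, ∑ y, f x y = 0 := by
  rw [← Finset.sum_product']
  refine Finset.sum_involution (fun p _ => (p.2, p.1)) ?_ ?_ ?_ ?_
  · rintro ⟨x, y⟩ _
    simp [hf x y]
  · rintro ⟨x, y⟩ _ h1 h2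
    have hyx : y = x := (Prod.mk.inj h2).1
    subst hyx
    exact h1 (hd _)
  · simp
  · simp

theorem isAlternating₃_sliceTransform (ψ : AddChar (ZMod n) K) (a : ZMod n)
    {f : ZMod n → ZMod n → ZMod n → K} (hf : IsAlternating₃ f) :
    IsAlternating₃ (sliceTransform ψ a f) where
  swap_left i j k := by
    unfold sliceTransform
    rw [Finset.sum_comm, ← Finset.sum_neg_distrib]
    refine Finset.sum_congr rfl fun x _ => ?_
    rw [← Finset.sum_neg_distrib]
    refine Finset.sum_congr rfl fun y _ => ?_
    rw [← Finset.sum_neg_distrib]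
    refine Finset.sum_congr rfl fun z _ => ?_
    rw [hf.swap_left x y z, add_comm y x, add_comm (j * y)]
    split_ifs <;> simp
  swap_right i j k := by
    unfold sliceTransform
    rw [← Finset.sum_neg_distrib]
    refine Finset.sum_congr rfl fun x _ => ?_
    rw [Finset.sum_comm, ← Finset.sum_neg_distrib]
    refine Finset.sum_congr rfl fun y _ => ?_
    rw [← Finset.sum_neg_distrib]
    refine Finset.sum_congr rfl fun z _ => ?_
    rw [hf.swap_right x y z, add_right_comm x z y, add_right_comm (i * x)]
    split_ifs <;> simp
  diag i k := by
    unfold sliceTransform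
    refine sum_sum_eq_zero_of_antisymm _ (fun x y => ?_) (fun x => ?_)
    · rw [← Finset.sum_neg_distrib]
      refine Finset.sum_congr rfl fun z _ => ?_
      rw [hf.swap_left x y z, add_comm y x, add_comm (i * y)]
      split_ifs <;> simp
    · simp [hf.diag]

theorem sliceTransform_shift (ψ : AddChar (ZMod n) K) (a t : ZMod n)
    (f : ZMod n → ZMod n → ZMod n → K) (i j k : ZMod n) :
    sliceTransform ψ a f (i + t) (j + t) (k + t) =
      ψ (-(t * a)) * sliceTransform ψ a f i j k := by
  simp only [sliceTransform, Finset.mul_sum]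
  refine Finset.sum_congr rfl fun x _ => Finset.sum_congr rfl fun y _ =>
    Finset.sum_congr rfl fun z _ => ?_
  split_ifs with h
  · subst h
    rw [mul_left_comm, ← AddChar.map_add_eq_mul]
    congr 2
    ring
  · simp

theorem eq_zero_of_transform_eq_zero {ψ : AddChar (ZMod n) K} (hψ : ψ.IsPrimitive)
    (hn : (n : K) ≠ 0) (g : ZMod n → K) (hg : ∀ i, ∑ x, g x * ψ (-(i * x)) = 0) : g = 0 := by
  funext x₀
  have h : ∑ i, ψ (i * x₀) * ∑ x, g x * ψ (-(i * x)) = n * g x₀ := by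
    simp only [Finset.mul_sum]
    rw [Finset.sum_comm]
    have : ∀ x, ∑ i, ψ (i * x₀) * (g x * ψ (-(i * x))) =
        g x * ∑ i, ψ (i * (x₀ - x)) := by
      intro x
      rw [Finset.mul_sum]
      refine Finset.sum_congr rfl fun i _ => ?_
      rw [mul_left_comm, ← AddChar.map_add_eq_mul]
      congr 2
      ring
    simp only [this, AddChar.sum_mulShift _ hψ, sub_eq_zero]
    simp [mul_comm]
  simp only [hg, mul_zero, Finset.sum_const_zero] at h
  exact (mul_eq_zero.mp h.symm).resolve_left hn

theorem eq_zero_of_sliceTransform_eq_zero {ψ : AddChar (ZMod n) K} (hψ : ψ.IsPrimitive)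
    (hn : (n : K) ≠ 0) {a : ZMod n} {f : ZMod n → ZMod n → ZMod n → K}
    (h : ∀ i j, sliceTransform ψ a f i j 0 = 0) {x y z : ZMod n} (hxyz : x + y + z = a) :
    f x y z = 0 := by
  have h1 : ∀ i j, ∑ x, (∑ y, f x y (a - x - y) * ψ (-(j * y))) * ψ (-(i * x)) = 0 := by
    intro i j
    rw [← h i j]
    unfold sliceTransform
    refine Finset.sum_congr rfl fun x _ => ?_
    rw [Finset.sum_mul]
    refine Finset.sum_congr rfl fun y _ => ?_
    have : ∀ z, x + y + z = a ↔ z = a - x - y := fun z =>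
      ⟨fun h => by rw [← h]; ring, fun h => by rw [h]; ring⟩
    simp only [this, Finset.sum_ite_eq', Finset.mem_univ, if_true]
    rw [mul_assoc, ← AddChar.map_add_eq_mul]
    congr 2
    ring
  have h2 : ∀ j, (fun x => ∑ y, f x y (a - x - y) * ψ (-(j * y))) = 0 := fun j =>
    eq_zero_of_transform_eq_zero hψ hn _ fun i => h1 i j
  have h3 : (fun y => f x y (a - x - y)) = 0 :=
    eq_zero_of_transform_eq_zero hψ hn _ fun j => congrFun (h2 j) x
  have h4 := congrFun h3 y
  have hz : a - x - y = z := by rw [← hxyz]; ring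
  simpa only [hz, Pi.zero_apply] using h4

theorem sum_sliceTransform_eq_zero (ψ : AddChar (ZMod n) K) (A : Finset (ZMod n))
    {f : ZMod n → ZMod n → ZMod n → K} (hA : ∀ x y z, x + y + z ∉ A → f x y z = 0)
    (hf : ∀ y z, ∑ x, f x y z = 0) (i j k : ZMod n) :
    ∑ a ∈ A, ψ (i * a) * sliceTransform ψ a f i j k = 0 := by
  have h : ∀ a, ψ (i * a) * sliceTransform ψ a f i j k =
      sliceTransform ψ a f 0 (j - i) (k - i) := by
    intro a
    have := sliceTransform_shift ψ a (-i) f i j k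
    simp only [add_neg_cancel, neg_mul, neg_neg, ← sub_eq_add_neg] at this
    exact this.symm
  simp only [h]
  simp only [sliceTransform]
  rw [Finset.sum_comm]
  have h1 : ∀ x, ∑ a ∈ A, ∑ y, ∑ z, (if x + y + z = a then
      f x y z * ψ (-(0 * x + (j - i) * y + (k - i) * z)) else 0) =
      ∑ y, ∑ z, f x y z * ψ (-((j - i) * y + (k - i) * z)) := by
    intro x
    rw [Finset.sum_comm]
    refine Finset.sum_congr rfl fun y _ => ?_
    rw [Finset.sum_comm]
    refine Finset.sum_congr rfl fun z _ => ?_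
    rw [Finset.sum_ite_eq]
    split_ifs with hmem
    · simp
    · simp [hA x y z hmem]
  simp only [h1]
  rw [Finset.sum_comm]
  refine Finset.sum_eq_zero fun y _ => ?_
  rw [Finset.sum_comm]
  refine Finset.sum_eq_zero fun z _ => ?_
  rw [← Finset.sum_mul, hf, zero_mul]

/-- A trinomial `h₀ + h₁ X + h₃ X³` with three distinct roots has nonzero leading
coefficient only if the roots sum to zero. -/
theorem add_eq_zero_or_of_trinomial {α β γ h₀ h₁ h₃ : K} (hβγ : β ≠ γ) (hαβ : α ≠ β)
    (hαγ : α ≠ γ) (hα : h₀ + α * h₁ + α ^ 3 * h₃ = 0) (hβ : h₀ + β * h₁ + β ^ 3 * h₃ = 0)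
    (hγ : h₀ + γ * h₁ + γ ^ 3 * h₃ = 0) :
    (α + β + γ = 0 ∨ h₃ = 0) ∧ (h₃ = 0 → h₁ = 0 ∧ h₀ = 0) := by
  constructor
  · have h : (α - β) * (α - γ) * (β - γ) * ((α + β + γ) * h₃) = 0 := by
      linear_combination (β - γ) * hα + (γ - α) * hβ + (α - β) * hγ
    simpa [sub_eq_zero, hαβ, hαγ, hβγ] using h
  · rintro rfl
    have h : (α - β) * h₁ = 0 := by linear_combination hα - hβ
    have h1 : h₁ = 0 := (mul_eq_zero.mp h).resolve_left (sub_ne_zero.mpr hαβ)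
    exact ⟨h1, by simpa [h1] using hα⟩

theorem sum_cubicWeight_mul (ψ : AddChar (ZMod n) K) {i j k : ZMod n} (h : i + j + k = 0)
    (hψ : ψ i + ψ j + ψ k = 0) : ∑ s, cubicWeight ψ i j k s * ψ (i * s) = 0 := by
  have hprod : ψ i * ψ j * ψ k = 1 := by
    rw [← AddChar.map_add_eq_mul, ← AddChar.map_add_eq_mul, h, AddChar.map_zero_eq_one]
  simp only [cubicWeight, Pi.add_apply, add_mul, Finset.sum_add_distrib, Pi.single_apply,
    ite_mul, zero_mul, Finset.sum_ite_eq', Finset.mem_univ, if_true, mul_zero, mul_one,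
    AddChar.map_zero_eq_one, addChar_three_mul]
  linear_combination ψ i ^ 2 * hψ + hprod

theorem sum_weight_add_mul (ψ : AddChar (ZMod n) K) (w : ZMod n → K) {i : ZMod n}
    (h : ∑ s, w s * ψ (i * s) = 0) (t : ZMod n) : ∑ x, w (x + t) * ψ (i * x) = 0 := by
  have h1 : ∀ x, w (x + t) * ψ (i * x) = ψ (-(i * t)) * (w (x + t) * ψ (i * (x + t))) := by
    intro x
    rw [mul_left_comm, ← AddChar.map_add_eq_mul]
    congr 2
    ring
  simp only [h1, ← Finset.mul_sum]
  have h2 := Equiv.sum_comp (Equiv.addRight t) (fun s => w s * ψ (i * s))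
  simp only [Equiv.coe_addRight] at h2
  rw [h2, h, mul_zero]

theorem sum_fourierCycle (ψ : AddChar (ZMod n) K) {i j k : ZMod n} (h : i + j + k = 0)
    (hψ : ψ i + ψ j + ψ k = 0) (y z : ZMod n) : ∑ x, fourierCycle ψ i j k x y z = 0 := by
  have hi := sum_weight_add_mul ψ _ (sum_cubicWeight_mul ψ h hψ) (y + z)
  have hj := sum_weight_add_mul ψ _ (sum_cubicWeight_mul ψ (i := j) (j := k) (k := i)
    (by rw [← h]; ring) (by rw [← hψ]; ring)) (y + z)
  have hk := sum_weight_add_mul ψ _ (sum_cubicWeight_mul ψ (i := k) (j := i) (k := j)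
    (by rw [← h]; ring) (by rw [← hψ]; ring)) (y + z)
  rw [cubicWeight_rotate ψ i j k] at hj
  rw [← cubicWeight_rotate ψ k i j] at hk
  have h1 : ∀ x, fourierCycle ψ i j k x y z =
      cubicWeight ψ i j k (x + (y + z)) * ψ (i * x) *
        (ψ (j * y) * ψ (k * z) - ψ (k * y) * ψ (j * z)) -
      cubicWeight ψ i j k (x + (y + z)) * ψ (j * x) *
        (ψ (i * y) * ψ (k * z) - ψ (k * y) * ψ (i * z)) +
      cubicWeight ψ i j k (x + (y + z)) * ψ (k * x) *
        (ψ (i * y) * ψ (j * z) - ψ (j * y) * ψ (i * z)) := by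
    intro x
    rw [fourierCycle, charMinor, add_assoc x y z]
    ring
  simp only [h1, Finset.sum_add_distrib, Finset.sum_sub_distrib, ← Finset.sum_mul, hi, hj, hk]
  ring

theorem sum_characters_slice {ψ : AddChar (ZMod n) K} (hψ : ψ.IsPrimitive)
    (h3 : IsUnit (3 : ZMod n)) {i j k i' j' k' : ZMod n} (h : i + j + k = 0)
    (h' : i' + j' + k' = 0) (a : ZMod n) :
    sliceTransform ψ a (fun x y z => ψ (i * x) * ψ (j * y) * ψ (k * z)) i' j' k' =
      if i = i' ∧ j = j' ∧ k = k' then (n : K) ^ 2 else 0 := by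
  have key : ∀ x y, (∑ z, if x + y + z = a then
      ψ (i * x) * ψ (j * y) * ψ (k * z) * ψ (-(i' * x + j' * y + k' * z)) else 0) =
      ψ ((k - k') * a) * ψ (x * ((i - i') - (k - k'))) * ψ (y * ((j - j') - (k - k'))) := by
    intro x y
    have : ∀ z, x + y + z = a ↔ z = a - x - y := fun z =>
      ⟨fun h => by rw [← h]; ring, fun h => by rw [h]; ring⟩
    simp only [this, Finset.sum_ite_eq', Finset.mem_univ, if_true, ← AddChar.map_add_eq_mul]
    congr 1
    ring
  simp only [sliceTransform, key, ← Finset.mul_sum, ← Finset.sum_mul,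
    AddChar.sum_mulShift _ hψ, ZMod.card]
  by_cases hc : i = i' ∧ j = j' ∧ k = k'
  · obtain ⟨rfl, rfl, rfl⟩ := hc
    simp [sq]
  · rw [if_neg hc]
    by_cases h1 : i - i' - (k - k') = 0
    · by_cases h2 : j - j' - (k - k') = 0
      · exfalso
        have hk : (3 : ZMod n) * (k - k') = 3 * 0 := by
          linear_combination h - h' - h1 - h2
        have hk' := h3.mul_left_cancel hk
        rw [hk', sub_zero, sub_eq_zero] at h1 h2
        exact hc ⟨h1, h2, sub_eq_zero.mp hk'⟩
      · simp [h2]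
    · simp [h1]

end Fourier

section Dimension

variable {n : ℕ} [NeZero n] {K : Type*} [Field K] {ψ : AddChar (ZMod n) K}

theorem addChar_injective_of_isPrimitive (hψ : ψ.IsPrimitive) : Function.Injective ψ := by
  intro i j h
  have h1 : ψ (i - j) = 1 := by
    rw [AddChar.map_sub_eq_div, h, div_self]
    exact fun h0 => by simpa [← AddChar.map_add_eq_mul] using congrArg (· * ψ (-j)) h0
  exact sub_eq_zero.mp ((hψ.zmod_char_eq_one_iff n _).mp h1)

/-- An alternating cycle whose transform has vanishing leading coefficients vanishes. -/
theorem eq_zero_of_leading_eq_zero (hψ : ψ.IsPrimitive) (hn : (n : K) ≠ 0)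
    (h3 : IsUnit (3 : ZMod n)) (h01 : (0 : ZMod n) ≠ 1) (h13 : (1 : ZMod n) ≠ 3)
    {f : ZMod n → ZMod n → ZMod n → K} (hf : IsAlternating₃ f)
    (hA : ∀ x y z, x + y + z ∉ ({0, 1, 3} : Finset (ZMod n)) → f x y z = 0)
    (hsum : ∀ y z, ∑ x, f x y z = 0)
    (hlead : ∀ i j k, i ≠ j → i ≠ k → j ≠ k → i + j + k = 0 → ψ i + ψ j + ψ k = 0 →
      sliceTransform ψ 3 f i j k = 0) (x y z : ZMod n) : f x y z = 0 := by
  have hinj := addChar_injective_of_isPrimitive hψ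
  have h03 : (0 : ZMod n) ≠ 3 := by
    intro h
    rw [← h, isUnit_zero_iff] at h3
    exact h01 h3
  have hrel : ∀ i j k, sliceTransform ψ 0 f i j k + ψ i * sliceTransform ψ 1 f i j k +
      ψ i ^ 3 * sliceTransform ψ 3 f i j k = 0 := by
    intro i j k
    have := sum_sliceTransform_eq_zero ψ {0, 1, 3} hA hsum i j k
    rw [Finset.sum_insert (by simp [h01, h03]), Finset.sum_pair h13, mul_zero,
      AddChar.map_zero_eq_one, mul_one, one_mul, addChar_three_mul] at this
    rw [← this]
    ring
  have hperm : ∀ a i j k, sliceTransform ψ a f j i k = -sliceTransform ψ a f i j k :=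
    fun a => (isAlternating₃_sliceTransform ψ a hf).swap_left
  have hperm' : ∀ a i j k, sliceTransform ψ a f k j i = -sliceTransform ψ a f i j k := by
    intro a i j k
    have h := isAlternating₃_sliceTransform ψ a hf
    rw [h.swap_right k i j, h.swap_left i k j, h.swap_right i j k, neg_neg]
  have hzero : ∀ i j k, i + j + k = 0 → ∀ a ∈ ({0, 1, 3} : Finset (ZMod n)),
      sliceTransform ψ a f i j k = 0 := by
    intro i j k hijk a ha
    by_cases hij : i = j
    · subst hij
      exact (isAlternating₃_sliceTransform ψ a hf).diag _ _
    by_cases hik : i = k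
    · subst hik
      exact (isAlternating₃_sliceTransform ψ a hf).diag_outer _ _
    by_cases hjk : j = k
    · subst hjk
      exact (isAlternating₃_sliceTransform ψ a hf).diag_right _ _
    have hj := hrel j i k
    have hk := hrel k j i
    simp only [hperm _ i j k] at hj
    simp only [hperm' _ i j k] at hk
    obtain ⟨h1, h2⟩ := add_eq_zero_or_of_trinomial (hinj.ne hjk) (hinj.ne hij) (hinj.ne hik)
      (hrel i j k) (by linear_combination -hj) (by linear_combination -hk)
    have h4 : sliceTransform ψ 3 f i j k = 0 := h1.elim (hlead i j k hij hik hjk hijk) id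
    simp only [Finset.mem_insert, Finset.mem_singleton] at ha
    rcases ha with rfl | rfl | rfl
    · exact (h2 h4).2
    · exact (h2 h4).1
    · exact h4
  by_cases hxyz : x + y + z ∈ ({0, 1, 3} : Finset (ZMod n))
  · refine eq_zero_of_sliceTransform_eq_zero hψ hn (fun i j => ?_) rfl
    obtain ⟨t, ht⟩ := h3.dvd (a := i + j)
    have h1 := hzero (i - t) (j - t) (0 - t) (by linear_combination ht) _ hxyz
    have h2 := sliceTransform_shift ψ (x + y + z) t f (i - t) (j - t) (0 - t)
    rw [h1, mul_zero, sub_add_cancel, sub_add_cancel, sub_add_cancel] at h2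
    exact h2
  · exact hA x y z hxyz

theorem sliceTransform_fourierCycle (hψ : ψ.IsPrimitive) (h3 : IsUnit (3 : ZMod n))
    (h01 : (0 : ZMod n) ≠ 1) (h13 : (1 : ZMod n) ≠ 3)
    {i j k i' j' k' : ZMod n} (h : i + j + k = 0) (h' : i' + j' + k' = 0) :
    sliceTransform ψ 3 (fourierCycle ψ i j k) i' j' k' =
      (if i = i' ∧ j = j' ∧ k = k' then (n : K) ^ 2 else 0) -
      (if i = i' ∧ k = j' ∧ j = k' then (n : K) ^ 2 else 0) -
      (if j = i' ∧ i = j' ∧ k = k' then (n : K) ^ 2 else 0) +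
      (if j = i' ∧ k = j' ∧ i = k' then (n : K) ^ 2 else 0) +
      (if k = i' ∧ i = j' ∧ j = k' then (n : K) ^ 2 else 0) -
      (if k = i' ∧ j = j' ∧ i = k' then (n : K) ^ 2 else 0) := by
  have h03 : (3 : ZMod n) ≠ 0 := by
    intro h
    rw [h, isUnit_zero_iff] at h3
    exact h01 h3
  have hw : cubicWeight ψ i j k 3 = 1 := by
    simp [cubicWeight, h03, h13.symm]
  rw [← sum_characters_slice hψ h3 (by rw [← h]) h' 3,
    ← sum_characters_slice hψ h3 (i := i) (j := k) (k := j) (by rw [← h]; ring) h' 3,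
    ← sum_characters_slice hψ h3 (i := j) (j := i) (k := k) (by rw [← h]; ring) h' 3,
    ← sum_characters_slice hψ h3 (i := j) (j := k) (k := i) (by rw [← h]; ring) h' 3,
    ← sum_characters_slice hψ h3 (i := k) (j := i) (k := j) (by rw [← h]; ring) h' 3,
    ← sum_characters_slice hψ h3 (i := k) (j := j) (k := i) (by rw [← h]; ring) h' 3]
  simp only [sliceTransform, ← Finset.sum_sub_distrib, ← Finset.sum_add_distrib]
  refine Finset.sum_congr rfl fun x _ => Finset.sum_congr rfl fun y _ =>
    Finset.sum_congr rfl fun z _ => ?_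
  split_ifs with hxyz
  · rw [fourierCycle, hxyz, hw, charMinor]
    ring
  · ring

/-- The triples of exponents with sum zero whose roots of unity also sum to zero. -/
noncomputable def vanishingTriples (ψ : AddChar (ZMod n) K) : Finset (Finset (ZMod n)) := by
  classical
  exact Finset.univ.filter fun T => T.card = 3 ∧ ∑ i ∈ T, i = 0 ∧ ∑ i ∈ T, ψ i = 0

theorem mem_vanishingTriples {T : Finset (ZMod n)} :
    T ∈ vanishingTriples ψ ↔ T.card = 3 ∧ ∑ i ∈ T, i = 0 ∧ ∑ i ∈ T, ψ i = 0 := by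
  simp [vanishingTriples]

/-- The leading coefficient of the transform of a chain at a triple of frequencies. -/
def leadingTransform (ψ : AddChar (ZMod n) K) (i j k : ZMod n) :
    (Finset (ZMod n) → K) →ₗ[K] K where
  toFun c := sliceTransform ψ 3 (alternatize c) i j k
  map_add' c d := by
    simp only [sliceTransform, ← Finset.sum_add_distrib]
    refine Finset.sum_congr rfl fun x _ => Finset.sum_congr rfl fun y _ =>
      Finset.sum_congr rfl fun z _ => ?_
    split_ifs <;> simp [alternatize, mul_add, add_mul]
  map_smul' r c := by
    simp only [sliceTransform, Finset.smul_sum, RingHom.id_apply]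
    refine Finset.sum_congr rfl fun x _ => Finset.sum_congr rfl fun y _ =>
      Finset.sum_congr rfl fun z _ => ?_
    split_ifs
    · simp only [alternatize, Pi.smul_apply, smul_eq_mul]
      ring
    · simp

theorem zero_ne_one_and_one_ne_three_of_card_eq_three {σ : Finset (ZMod n)}
    (hσ : σ.card = 3) : (0 : ZMod n) ≠ 1 ∧ (1 : ZMod n) ≠ 3 := by
  have hcard : 3 ≤ n := by
    simpa [hσ] using Finset.card_le_univ σ
  have : Fact (1 < n) := ⟨by omega⟩
  refine ⟨zero_ne_one, fun h => ?_⟩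
  have h2 : ((2 : ℕ) : ZMod n) = 0 := by
    push_cast
    linear_combination -h
  rw [ZMod.natCast_eq_zero_iff] at h2
  have := Nat.le_of_dvd (by norm_num) h2
  omega

theorem hTop_eq_card_vanishingTriples (hψ : ψ.IsPrimitive) (hn : (n : K) ≠ 0)
    (h3 : IsUnit (3 : ZMod n)) :
    hTop n K 2 ({0, 1, 3} : Finset (ZMod n)) = (vanishingTriples ψ).card := by
  classical
  have htriple : ∀ T : vanishingTriples ψ, ∃ i j k : ZMod n, i ≠ j ∧ i ≠ k ∧ j ≠ k ∧
      (T : Finset (ZMod n)) = {i, j, k} ∧ i + j + k = 0 ∧ ψ i + ψ j + ψ k = 0 := by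
    rintro ⟨T, hT⟩
    obtain ⟨hcard, hsum, hψsum⟩ := mem_vanishingTriples.mp hT
    obtain ⟨i, j, k, hij, hik, hjk, rfl⟩ := Finset.card_eq_three.mp hcard
    rw [Finset.sum_insert (by simp [hij, hik]), Finset.sum_pair hjk, ← add_assoc] at hsum hψsum
    exact ⟨i, j, k, hij, hik, hjk, rfl, hsum, hψsum⟩
  choose I J L hIJ hIL hJL hT hsum hψsum using htriple
  rw [hTop_eq_finrank_ker_cycleMatrix]
  set N := LinearMap.ker (Matrix.toLin' (cycleMatrix n K 2 ({0, 1, 3} : Finset (ZMod n))))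
  have hmem : ∀ c, c ∈ N ↔ (∀ σ ∉ sumComplexFacets n 2 ({0, 1, 3} : Finset (ZMod n)), c σ = 0) ∧
      bdry n K c = 0 := mem_ker_cycleMatrix n K 2 _
  let Φ : (Finset (ZMod n) → K) →ₗ[K] (vanishingTriples ψ → K) :=
    LinearMap.pi fun T => leadingTransform ψ (I T) (J T) (L T)
  have hΦ : ∀ c T, Φ c T = sliceTransform ψ 3 (alternatize c) (I T) (J T) (L T) :=
    fun _ _ => rfl
  have hinj : Function.Injective (Φ.domRestrict N) := by
    rw [injective_iff_map_eq_zero]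
    rintro ⟨c, hc⟩ hc0
    obtain ⟨hsupp, hbdry⟩ := (hmem c).mp hc
    ext σ
    by_cases hσ : σ ∈ sumComplexFacets n 2 ({0, 1, 3} : Finset (ZMod n))
    swap
    · exact hsupp σ hσ
    have hσ3 : σ.card = 3 := by
      simp only [sumComplexFacets, Finset.mem_filter] at hσ
      exact hσ.2.1
    obtain ⟨h01, h13⟩ := zero_ne_one_and_one_ne_three_of_card_eq_three hσ3
    obtain ⟨x, y, z, hxy, hxz, hyz, rfl⟩ := Finset.card_eq_three.mp hσ3
    have hc3 : ∀ σ, σ.card ≠ 3 → c σ = 0 := fun σ h => hsupp σ (by simp [sumComplexFacets, h])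
    have halt := isAlternating₃_alternatize c
    refine (alternatize_eq_zero_iff c hxy hxz hyz).mp ?_
    refine eq_zero_of_leading_eq_zero hψ hn h3 h01 h13 halt ?_
      ((bdry_eq_zero_iff c hc3).mp hbdry) ?_ x y z
    · intro x y z hA
      by_cases hxy : x = y
      · subst hxy
        exact halt.diag _ _
      by_cases hxz : x = z
      · subst hxz
        exact halt.diag_outer _ _
      by_cases hyz : y = z
      · subst hyz
        exact halt.diag_right _ _
      rw [alternatize_eq_zero_iff c hxy hxz hyz]
      refine hsupp _ fun h => hA ?_
      simp only [sumComplexFacets, Finset.mem_filter] at h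
      rw [Finset.sum_insert (by simp [hxy, hxz]), Finset.sum_pair hyz, ← add_assoc] at h
      exact h.2.2
    · intro i j k hij hik hjk hijk hψijk
      have hT' : ({i, j, k} : Finset (ZMod n)) ∈ vanishingTriples ψ := by
        rw [mem_vanishingTriples, Finset.sum_insert (by simp [hij, hik]), Finset.sum_pair hjk,
          Finset.sum_insert (by simp [hij, hik]), Finset.sum_pair hjk, ← add_assoc, ← add_assoc]
        exact ⟨Finset.card_eq_three.mpr ⟨i, j, k, hij, hik, hjk, rfl⟩, hijk, hψijk⟩
      let T : vanishingTriples ψ := ⟨_, hT'⟩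
      have h0 : sliceTransform ψ 3 (alternatize c) (I T) (J T) (L T) = 0 := by
        rw [← hΦ]
        exact congrFun hc0 T
      have hTset : ({i, j, k} : Finset (ZMod n)) = {I T, J T, L T} := hT T
      have hm : ∀ t ∈ ({I T, J T, L T} : Finset (ZMod n)), t = i ∨ t = j ∨ t = k := by
        rw [← hTset]
        simp
      have h1 := (isAlternating₃_sliceTransform ψ 3 halt).mul_eq_mul
        (isAlternating₃_tripleSign (F := K)) (hm (I T) (by simp)) (hm (J T) (by simp))
        (hm (L T) (by simp))
      rw [h0, zero_mul] at h1
      refine (mul_eq_zero.mp h1).resolve_right fun h2 => ?_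
      simpa [h2] using tripleSign_mul_self (F := K) (hIJ T) (hIL T) (hJL T)
  have hsurj : Function.Surjective (Φ.domRestrict N) := by
    have hbasis : ∀ T : vanishingTriples ψ, ∃ c : N,
        Φ.domRestrict N c = fun T' => if T = T' then (n : K) ^ 2 else 0 := by
      intro T
      obtain ⟨h01, h13⟩ := zero_ne_one_and_one_ne_three_of_card_eq_three
        (mem_vanishingTriples.mp T.2).1
      obtain ⟨c, hc3, hc⟩ :=
        exists_alternatize_eq (isAlternating₃_fourierCycle ψ (I T) (J T) (L T))
      refine ⟨⟨c, (hmem c).mpr ⟨fun σ hσ => ?_, ?_⟩⟩, ?_⟩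
      · by_cases hσ3 : σ.card = 3
        · obtain ⟨x, y, z, hxy, hxz, hyz, rfl⟩ := Finset.card_eq_three.mp hσ3
          rw [← alternatize_eq_zero_iff c hxy hxz hyz, hc, fourierCycle, cubicWeight_eq_zero,
            zero_mul]
          intro h
          refine hσ ?_
          simp only [sumComplexFacets, Finset.mem_filter]
          rw [Finset.sum_insert (by simp [hxy, hxz]), Finset.sum_pair hyz, ← add_assoc]
          exact ⟨Finset.mem_univ _, hσ3, h⟩
        · exact hc3 σ hσ3
      · rw [bdry_eq_zero_iff c hc3, hc]
        exact sum_fourierCycle ψ (hsum T) (hψsum T)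
      · funext T'
        rw [LinearMap.domRestrict_apply, hΦ, hc,
          sliceTransform_fourierCycle hψ h3 h01 h13 (hsum T) (hsum T')]
        by_cases hTT : T = T'
        · subst hTT
          simp [hIJ T, hIL T, hJL T, (hIJ T).symm, (hIL T).symm, (hJL T).symm]
        · have hne : ∀ p q r : ZMod n, ({p, q, r} : Finset (ZMod n)) = T →
              ¬ (p = I T' ∧ q = J T' ∧ r = L T') := by
            rintro p q r hp ⟨rfl, rfl, rfl⟩
            exact hTT (Subtype.ext (by rw [← hp, ← hT T']))
          have hTs := hT T
          rw [if_neg hTT, if_neg (hne _ _ _ ?_), if_neg (hne _ _ _ ?_), if_neg (hne _ _ _ ?_),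
            if_neg (hne _ _ _ ?_), if_neg (hne _ _ _ ?_), if_neg (hne _ _ _ ?_)]
          · simp
          all_goals
            first
            | exact hTs.symm
            | rw [hTs]
              ext t
              simp only [Finset.mem_insert, Finset.mem_singleton]
              tauto
    choose b hb using hbasis
    intro v
    refine ⟨∑ T, (v T * ((n : K) ^ 2)⁻¹) • b T, ?_⟩
    rw [map_sum]
    funext T'
    simp [hb, Finset.sum_apply, -LinearMap.domRestrict_apply, hn]
  rw [(LinearEquiv.ofBijective _ ⟨hinj, hsurj⟩).finrank_eq]
  simp

end Dimension

/-- Rotating a vanishing triple so that a chosen member becomes `1` yields all pairs of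
nontrivial roots of unity with sum `-1`, each exactly once. -/
theorem three_mul_card_vanishingTriples {n : ℕ} [NeZero n] {K : Type*} [Field K]
    {ψ : AddChar (ZMod n) K} (hψ : ψ.IsPrimitive) (h3 : IsUnit (3 : ZMod n))
    (hroot : ∀ x : K, x ^ n = 1 ↔ ∃ i, ψ i = x) :
    3 * (vanishingTriples ψ).card = Set.ncard {s : Finset K |
      s.card = 2 ∧ (∀ x ∈ s, x ^ n = 1 ∧ x ≠ 1) ∧ 1 + ∑ x ∈ s, x = 0} := by
  classical
  have hinj := addChar_injective_of_isPrimitive hψ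
  have hsubinj : ∀ t : ZMod n, Function.Injective fun i : ZMod n => i - t := fun t =>
    sub_left_injective
  let rot : (Σ _ : Finset (ZMod n), ZMod n) → Finset (ZMod n) := fun p =>
    (p.1.erase p.2).image (fun i => i - p.2)
  let P : Finset (Σ _ : Finset (ZMod n), ZMod n) := (vanishingTriples ψ).sigma id
  have hP : P.card = 3 * (vanishingTriples ψ).card := by
    have h : ∀ T ∈ vanishingTriples ψ, (id T).card = 3 := fun T hT =>
      (mem_vanishingTriples.mp hT).1
    rw [Finset.card_sigma, Finset.sum_congr rfl h, Finset.sum_const, smul_eq_mul, mul_comm]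
  have hPmem : ∀ T t, (⟨T, t⟩ : Σ _ : Finset (ZMod n), ZMod n) ∈ P ↔
      T ∈ vanishingTriples ψ ∧ t ∈ T := fun _ _ => Finset.mem_sigma
  have hInjOn : Set.InjOn (fun p => (rot p).image ψ) P := by
    rintro ⟨T, t⟩ hT ⟨T', t'⟩ hT' h
    have hrot : rot ⟨T, t⟩ = rot ⟨T', t'⟩ := Finset.image_injective hinj h
    have hsum : ∀ (T : Finset (ZMod n)) (t : ZMod n),
        (⟨T, t⟩ : Σ _ : Finset (ZMod n), ZMod n) ∈ P → ∑ i ∈ rot ⟨T, t⟩, i = -(3 * t) := by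
      intro T t hT
      obtain ⟨hT, ht⟩ := (hPmem _ _).mp hT
      obtain ⟨hcard, hsum, -⟩ := mem_vanishingTriples.mp hT
      simp only [rot]
      rw [Finset.sum_image (hsubinj t).injOn, Finset.sum_sub_distrib, Finset.sum_const,
        Finset.card_erase_of_mem ht, hcard]
      have := Finset.add_sum_erase T (fun i => i) ht
      simp only [hsum] at this
      simp only [nsmul_eq_mul]
      push_cast
      linear_combination this
    have h1 := hsum T t hT
    rw [hrot, hsum T' t' hT', neg_inj] at h1
    have htt : t' = t := h3.mul_left_cancel h1
    subst htt
    have herase : T.erase t' = T'.erase t' := Finset.image_injective (hsubinj t') hrot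
    have hTT : T = T' := by
      rw [← Finset.insert_erase ((hPmem _ _).mp hT).2, herase,
        Finset.insert_erase ((hPmem _ _).mp hT').2]
    rw [hTT]
  rw [← hP, ← Finset.card_image_of_injOn hInjOn, ← Set.ncard_coe_finset]
  congr 1
  ext s
  simp only [Finset.coe_image, Set.mem_image, Finset.mem_coe, Set.mem_ofPred_eq]
  constructor
  · rintro ⟨⟨T, t⟩, hTt, rfl⟩
    obtain ⟨hT, ht⟩ := (hPmem _ _).mp hTt
    obtain ⟨hcard, -, hsum⟩ := mem_vanishingTriples.mp hT
    refine ⟨?_, ?_, ?_⟩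
    · rw [Finset.card_image_of_injective _ hinj, Finset.card_image_of_injective _ (hsubinj t),
        Finset.card_erase_of_mem ht, hcard]
    · intro x hx
      obtain ⟨i, hi, rfl⟩ := Finset.mem_image.mp hx
      obtain ⟨j, hj, rfl⟩ := Finset.mem_image.mp hi
      refine ⟨(hroot _).mpr ⟨_, rfl⟩, fun h => Finset.ne_of_mem_erase hj ?_⟩
      exact sub_eq_zero.mp ((hψ.zmod_char_eq_one_iff n _).mp h)
    · rw [Finset.sum_image hinj.injOn, Finset.sum_image (hsubinj t).injOn]
      have h1 := Finset.add_sum_erase T (fun i => ψ (i - t)) ht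
      simp only [sub_self, AddChar.map_zero_eq_one] at h1
      rw [h1]
      simp only [sub_eq_add_neg, AddChar.map_add_eq_mul]
      rw [← Finset.sum_mul, hsum, zero_mul]
  · rintro ⟨hcard, hs, hsum⟩
    obtain ⟨u, v, huv, rfl⟩ := Finset.card_eq_two.mp hcard
    obtain ⟨b, rfl⟩ := (hroot u).mp (hs u (by simp)).1
    obtain ⟨c, rfl⟩ := (hroot v).mp (hs v (by simp)).1
    have hb : b ≠ 0 := by
      rintro rfl
      exact (hs (ψ 0) (by simp)).2 (AddChar.map_zero_eq_one ψ)
    have hc : c ≠ 0 := by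
      rintro rfl
      exact (hs (ψ 0) (by simp)).2 (AddChar.map_zero_eq_one ψ)
    have hbc : b ≠ c := fun h => huv (congrArg ψ h)
    rw [Finset.sum_pair huv] at hsum
    obtain ⟨t, ht⟩ := h3.dvd (a := -(b + c))
    have hT : ({b + t, c + t} : Finset (ZMod n)) = ({t, b + t, c + t} : Finset (ZMod n)).erase t := by
      rw [Finset.erase_insert]
      simp [hb, hc]
    refine ⟨⟨{t, b + t, c + t}, t⟩, (hPmem _ _).mpr ⟨mem_vanishingTriples.mpr ?_, ?_⟩, ?_⟩
    · have htb : t ∉ ({b + t, c + t} : Finset (ZMod n)) := by simp [hb, hc]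
      have hbc' : b + t ≠ c + t := fun h => hbc (add_right_cancel h)
      rw [Finset.card_insert_of_notMem htb, Finset.card_pair hbc', Finset.sum_insert htb,
        Finset.sum_pair hbc', Finset.sum_insert htb, Finset.sum_pair hbc']
      refine ⟨rfl, by linear_combination -ht, ?_⟩
      rw [AddChar.map_add_eq_mul, AddChar.map_add_eq_mul]
      linear_combination ψ t * hsum
    · simp
    · simp only [rot]
      rw [← hT]
      simp [Finset.image_insert]

/-- for `p` prime and `n` coprime to `3p`, with `k = 2` and
`A = {0,1,3} ⊆ ℤ_n`, `h_2(X_A; 𝔽_p)` equals one third of the number of unordered pairs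
`{u,v} ⊆ U_{p,n} ∖ {1}` with `u ≠ v` and `1 + u + v = 0`, where `U_{p,n}` is the group
of `n`-th roots of unity in an algebraic closure of `𝔽_p`. -/
theorem h1_of_013 (p : ℕ) [Fact p.Prime] (n : ℕ) [NeZero n]
    (hcop : Nat.Coprime n (3 * p)) :
    3 * hTop n (ZMod p) 2 ({0, 1, 3} : Finset (ZMod n)) =
      Set.ncard {s : Finset (AlgebraicClosure (ZMod p)) |
        s.card = 2 ∧ (∀ x ∈ s, x ^ n = 1 ∧ x ≠ 1) ∧ 1 + ∑ x ∈ s, x = 0} := by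
  have hn3 : Nat.Coprime 3 n := (Nat.Coprime.coprime_mul_right_right hcop).symm
  have hnp : Nat.Coprime n p := Nat.Coprime.coprime_mul_left_right hcop
  have h3 : IsUnit (3 : ZMod n) := by
    have := (ZMod.isUnit_iff_coprime 3 n).mpr hn3
    exact_mod_cast this
  have hn : (n : AlgebraicClosure (ZMod p)) ≠ 0 := by
    rw [Ne, CharP.cast_eq_zero_iff (AlgebraicClosure (ZMod p)) p]
    exact (Nat.Prime.coprime_iff_not_dvd Fact.out).mp hnp.symm
  have : NeZero (n : AlgebraicClosure (ZMod p)) := ⟨hn⟩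
  obtain ⟨ζ, hζ⟩ := HasEnoughRootsOfUnity.exists_primitiveRoot (AlgebraicClosure (ZMod p)) n
  have hψ := AddChar.zmodChar_primitive_of_primitive_root n hζ
  rw [hTop_eq_of_algebra n (ZMod p) (AlgebraicClosure (ZMod p)),
    hTop_eq_card_vanishingTriples hψ hn h3]
  refine three_mul_card_vanishingTriples hψ h3 fun x => ⟨fun hx => ?_, ?_⟩
  · obtain ⟨i, -, rfl⟩ := hζ.eq_pow_of_pow_eq_one hx
    exact ⟨(i : ZMod n), AddChar.zmodChar_apply' _ i⟩
  · rintro ⟨i, rfl⟩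
    rw [AddChar.zmodChar_apply, ← pow_mul, mul_comm, pow_mul, hζ.pow_eq_one, one_pow]
end
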